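/- arXiv:1312.1135 — 3 statements merged into one kernel-verified Lean document; each statement's English description precedes it below -/
import Mathlib

section
/- Let F_q be a finite field with q = b^m elements, where b is prime and m ≥ 1. Let f ∈ F_q[z] be a nonzero polynomial of degree s ≥ 1 such that s < q and gcd(s, q) = 1, and let ψ be a non-trivial additive character of F_q. Then |∑_{z ∈ F_q} ψ(f(z))| ≤ (s − 1)·√q. -/
section
open Polynomial

lemma weil_root (r : ℝ) (hr : 0 < r) (L : ℂ[X]) (S : ℕ → ℂ) (C : ℝ) (h0 : L.coeff 0 = 1)
    (hS : ∀ n, ‖S (n+1)‖ ≤ C * r ^ (n+1))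
    (hrec : (PowerSeries.derivative ℂ (L : PowerSeries ℂ)) = (L : PowerSeries ℂ) * PowerSeries.mk (fun n => S (n+1)))
    (z : ℂ) (hz : L.eval z = 0) : 1 ≤ ‖z‖ * r := by
  by_contra! hlt
  have hL : L ≠ 0 := by rintro rfl; simp at h0
  obtain ⟨M, hM, hdvd⟩ := Polynomial.exists_eq_pow_rootMultiplicity_mul_and_not_dvd L hL z
  have hm : 0 < L.rootMultiplicity z := (Polynomial.rootMultiplicity_pos hL).2 hz
  obtain ⟨k, hk⟩ := Nat.exists_eq_succ_of_ne_zero hm.ne'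
  rw [hk, Nat.succ_eq_add_one] at hM
  set G : PowerSeries ℂ := PowerSeries.mk (fun n => S (n+1)) with hG
  have hMz : M.eval z ≠ 0 := fun h => hdvd (Polynomial.dvd_iff_isRoot.2 h)
  set A : ℂ[X] := ((k+1 : ℕ) : ℂ[X]) * M + (X - Polynomial.C z) * derivative M with hA
  have key : (A : PowerSeries ℂ) = (((X - Polynomial.C z) * M : ℂ[X]) : PowerSeries ℂ) * G := by
    have h1 : derivative L = (X - Polynomial.C z)^k * A := by
      rw [hM, derivative_mul, derivative_X_sub_C_pow, hA]
      simp
      ring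
    have h2 : ((derivative L : ℂ[X]) : PowerSeries ℂ) = (L : PowerSeries ℂ) * G := by
      rw [← hrec]; exact (PowerSeries.derivative_coe L).symm
    rw [h1, hM] at h2
    have h3 : (((X - Polynomial.C z)^k : ℂ[X]) : PowerSeries ℂ) ≠ 0 := by
      rw [Ne, Polynomial.coe_eq_zero_iff]
      exact pow_ne_zero _ (X_sub_C_ne_zero z)
    apply mul_left_cancel₀ h3
    rw [← Polynomial.coe_mul, h2, ← mul_assoc, ← Polynomial.coe_mul]
    congr 2
    ring
  have hev : ∀ B : ℂ[X], HasSum (fun n => B.coeff n * z^n) (B.eval z) := by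
    intro B
    rw [Polynomial.eval_eq_sum_range]
    apply hasSum_sum_of_ne_finset_zero
    intro n hn
    rw [Polynomial.coeff_eq_zero_of_natDegree_lt, zero_mul]
    simpa using hn
  have hevn : ∀ B : ℂ[X], Summable (fun n => ‖B.coeff n * z^n‖) := by
    intro B
    apply summable_of_ne_finset_zero (s := Finset.range (B.natDegree+1))
    intro n hn
    rw [Polynomial.coeff_eq_zero_of_natDegree_lt, zero_mul, norm_zero]
    simpa using hn
  have hGs : Summable (fun n => ‖S (n+1) * z^n‖) := by
    have hgeo : Summable (fun n : ℕ => (C * r) * (‖z‖ * r)^n) :=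
      (summable_geometric_of_lt_one (by positivity) hlt).mul_left _
    refine Summable.of_nonneg_of_le (fun _ => norm_nonneg _) (fun n => ?_) hgeo
    rw [norm_mul, norm_pow]
    calc _ ≤ C * r^(n+1) * ‖z‖^n := by gcongr; exact hS n
      _ = _ := by ring
  have hmul := tsum_mul_tsum_eq_tsum_sum_antidiagonal_of_summable_norm
    (hevn ((X - Polynomial.C z) * M)) hGs
  rw [(hev _).tsum_eq] at hmul
  have : ∀ n, ∑ kl ∈ Finset.HasAntidiagonal.antidiagonal n, ((X - Polynomial.C z) * M).coeff kl.1 * z ^ kl.1 * (S (kl.2 + 1) * z ^ kl.2)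
      = A.coeff n * z^n := by
    intro n
    rw [← Polynomial.coeff_coe A, key, PowerSeries.coeff_mul, Finset.sum_mul]
    refine Finset.sum_congr rfl fun kl hkl => ?_
    rw [← Finset.HasAntidiagonal.mem_antidiagonal.1 hkl, pow_add, Polynomial.coeff_coe, hG, PowerSeries.coeff_mk]
    ring
  simp_rw [this] at hmul
  rw [(hev A).tsum_eq] at hmul
  simp [hA] at hmul
  rcases hmul with h | h
  · exact absurd h (by exact_mod_cast Nat.succ_ne_zero k)
  · exact hMz h

lemma weil_analytic (r : ℝ) (hr : 0 < r) (s : ℕ) (hs : 1 ≤ s) (c S : ℕ → ℂ) (C : ℝ) (h0 : c 0 = 1)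
    (hc : ∀ d, s ≤ d → c d = 0)
    (hS : ∀ n, ‖S (n+1)‖ ≤ C * r ^ (n+1))
    (hrec : ∀ d : ℕ, ((d : ℂ)+1) * c (d+1) = ∑ kl ∈ Finset.HasAntidiagonal.antidiagonal d, c kl.1 * S (kl.2 + 1)) :
    ‖c 1‖ ≤ ((s:ℝ) - 1) * r := by
  let L : ℂ[X] := ∑ i ∈ Finset.range s, Polynomial.C (c i) * X^i
  have hcoeff : ∀ n, L.coeff n = c n := by
    intro n
    simp only [L, finsetSum_coeff, coeff_C_mul_X_pow]
    rw [Finset.sum_ite_eq]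
    split_ifs with h
    · rfl
    · exact (hc n (by simpa using h)).symm
  have hroot := weil_root r hr L S C (by rw [hcoeff, h0]) hS (by
    ext d
    rw [PowerSeries.coeff_derivative, PowerSeries.coeff_mul, Polynomial.coeff_coe, hcoeff, mul_comm, hrec]
    refine Finset.sum_congr rfl fun kl _ => ?_
    rw [Polynomial.coeff_coe, hcoeff, PowerSeries.coeff_mk])
  have hL0 : L.eval 0 = 1 := by rw [← coeff_zero_eq_eval_zero, hcoeff, h0]
  have hL : L ≠ 0 := by intro h; simp [h] at hL0
  have hd := (IsAlgClosed.splits L).eval_derivative_div_eval_of_ne_zero (x := 0) (by rw [hL0]; exact one_ne_zero)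
  rw [hL0, div_one, ← coeff_zero_eq_eval_zero, coeff_derivative, hcoeff] at hd
  simp only [zero_add, Nat.cast_zero, mul_one] at hd
  rw [hd]
  have hcard : (L.roots.card : ℝ) ≤ (s:ℝ) - 1 := by
    have h1 := L.card_roots'
    have h2 : L.natDegree ≤ s - 1 := by
      rw [natDegree_le_iff_coeff_eq_zero]
      intro N hN
      rw [hcoeff]; exact hc _ (by omega)
    have : (L.roots.card : ℝ) ≤ ((s - 1 : ℕ) : ℝ) := by exact_mod_cast h1.trans h2
    rwa [Nat.cast_sub hs, Nat.cast_one] at this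
  have : ∀ T : Multiset ℂ, (∀ z ∈ T, 1 ≤ ‖z‖ * r) → ‖(T.map (fun z => 1 / (0 - z))).sum‖ ≤ T.card * r := by
    intro T
    induction T using Multiset.induction with
    | empty => simp
    | cons a T ih =>
      intro h
      have ha := h a (Multiset.mem_cons_self _ _)
      have := ih (fun z hz => h z (Multiset.mem_cons_of_mem hz))
      rw [Multiset.map_cons, Multiset.sum_cons, Multiset.card_cons]
      refine (norm_add_le _ _).trans ?_
      have h3 : ‖1 / (0 - a)‖ ≤ r := by
        have : 0 < ‖a‖ := by
          rcases (norm_nonneg a).lt_or_eq with h | h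
          · exact h
          · rw [← h] at ha; simp at ha; linarith
        simp
        rw [inv_le_iff_one_le_mul₀ this]; linarith
      push_cast
      linarith
  refine (this _ fun z hz => hroot z ((mem_roots hL).1 hz)).trans ?_
  gcongr

lemma step_deg_u {K : Type*} [Field K] (f : K[X]) (q : ℕ) (hq : 2 ≤ q) (hs : 1 ≤ f.natDegree) (k : ℕ) :
    (∑ i ∈ Finset.range (k+1), f ^ q ^ i).natDegree = f.natDegree * q ^ k := by
  induction k with
  | zero => simp
  | succ k ih =>
    rw [Finset.sum_range_succ, natDegree_add_eq_right_of_natDegree_lt, natDegree_pow, mul_comm]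
    rw [ih, natDegree_pow, mul_comm]
    exact Nat.mul_lt_mul_of_pos_right (Nat.pow_lt_pow_right (by omega) (by omega)) (by omega)

lemma step_inj (q s w : ℕ) (hw : 0 < w) (hcop : Nat.Coprime s q) (i i1 a a1 j j1 : ℕ)
    (hi : i < w) (hi1 : i1 < w) (hj : j < q) (hj1 : j1 < q)
    (h : i + a * (q * w) + j * (s * w) = i1 + a1 * (q * w) + j1 * (s * w)) :
    i = i1 ∧ a = a1 ∧ j = j1 := by
  have e1 : i + w * (a * q + j * s) = i1 + w * (a1 * q + j1 * s) := by
    rw [show w * (a * q + j * s) = a * (q * w) + j * (s * w) by ring,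
      show w * (a1 * q + j1 * s) = a1 * (q * w) + j1 * (s * w) by ring]; omega
  have e2 : i = i1 := by
    have := congrArg (· % w) e1
    simpa [Nat.add_mul_mod_self_left, Nat.mod_eq_of_lt hi, Nat.mod_eq_of_lt hi1] using this
  subst e2
  have e3 : a * q + j * s = a1 * q + j1 * s := Nat.eq_of_mul_eq_mul_left hw (by omega)
  have e4 : j = j1 := by
    have h5 : j * s ≡ j1 * s [MOD q] := by
      have : (a * q + j * s) % q = (a1 * q + j1 * s) % q := by rw [e3]
      rw [mul_comm a, mul_comm a1] at this
      simpa [Nat.mul_add_mod, Nat.ModEq] using this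
    have := Nat.ModEq.cancel_right_of_coprime (by rw [Nat.gcd_comm]; exact hcop) h5
    exact Nat.ModEq.eq_of_lt_of_lt this hj hj1
  subst e4
  refine ⟨rfl, ?_, rfl⟩
  have : a * q = a1 * q := by omega
  exact Nat.eq_of_mul_eq_mul_right (by omega) this

lemma stepanov {K : Type*} [Field K] [IsAlgClosed K] (p m q : ℕ) [hp : Fact p.Prime] [CharP K p]
    (hqp : q = p ^ m) (hq : 2 ≤ q)
    (f : K[X]) (s : ℕ) (hdeg : f.natDegree = s) (hs : 1 ≤ s) (hcop : Nat.Coprime s q) (t : K)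
    (μ ν : ℕ) (hμν : μ ≤ ν) (Z : Finset K)
    (hZ : ∀ x ∈ Z, x ^ q ^ (μ + 1 + (ν + 1)) = x ∧
      ∑ i ∈ Finset.range (μ + 1 + (ν + 1)), f.eval x ^ q ^ i = t) :
    Z.card ≤ q ^ (μ + 1 + ν) + (4 * s + 1) * q ^ (ν + 1) := by
  haveI : ExpChar K p := ExpChar.prime hp.out
  set u : K[X] := ∑ i ∈ Finset.range (μ+1), f ^ q ^ i with hu
  set v : K[X] := ∑ i ∈ Finset.range (ν+1), f ^ q ^ i with hv
  have hudeg : u.natDegree = s * q ^ μ := by rw [hu, step_deg_u f q hq (by omega), hdeg]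
  have hvdeg : v.natDegree = s * q ^ ν := by rw [hv, step_deg_u f q hq (by omega), hdeg]
  have hv0 : v ≠ 0 := by
    rintro h; rw [h] at hvdeg; simp at hvdeg; omega
  set I := q ^ ν with hI
  set A := q ^ μ with hA
  have hA1 : 1 ≤ A := Nat.one_le_pow _ _ (by omega)
  have hI1 : 1 ≤ I := Nat.one_le_pow _ _ (by omega)
  have hAI : A ≤ I := Nat.pow_le_pow_right (by omega) hμν
  set J := A + 3 * s with hJ
  let ι := Fin I × Fin J × Fin q
  set D := q * A * I + J + (q-1) * (s * A) with hD
  let B : ι → K[X] := fun e => X ^ (e.1.1 * (q * A) + e.2.1.1) * (C t - u) ^ e.2.2.1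
  have hBdeg : ∀ e, B e ∈ degreeLT K D := by
    intro e
    rw [mem_degreeLT]
    have h1 : (B e).natDegree < D := by
      have h2 : (B e).natDegree ≤ (e.1.1 * (q * A) + e.2.1.1) + e.2.2.1 * (s * A) := by
        refine natDegree_mul_le.trans ?_
        rw [natDegree_X_pow]
        gcongr
        refine natDegree_pow_le.trans ?_
        gcongr
        refine (natDegree_sub_le _ _).trans ?_
        simp [hudeg]
      refine h2.trans_lt ?_
      have h3 : e.1.1 * (q * A) ≤ q * A * I := by
        rw [mul_comm (q * A)]; gcongr; exact e.1.2.le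
      have h4 : e.2.2.1 * (s * A) ≤ (q-1) * (s * A) := by
        gcongr; have := e.2.2.2; omega
      have := e.2.1.2
      omega
    exact (degree_le_natDegree).trans_lt (by exact_mod_cast h1)
  let Φ : (ι → K) →ₗ[K] degreeLT K D :=
    ∑ e : ι, (LinearMap.proj e).smulRight (⟨B e, hBdeg e⟩ : degreeLT K D)
  have hdim : Module.finrank K (degreeLT K D) < Module.finrank K (ι → K) := by
    rw [(degreeLTEquiv K D).finrank_eq]
    simp only [Module.finrank_fintype_fun_eq_card, Fintype.card_fin, ι, Fintype.card_prod]
    rw [hD, hJ]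
    have hsA : s * A ≤ s * A * (q - 1) := Nat.le_mul_of_pos_right _ (by omega)
    obtain ⟨r, rfl⟩ : ∃ r, q = r + 1 := ⟨q - 1, by omega⟩
    simp only [Nat.add_sub_cancel]
    have : r ≥ 1 := by omega
    have h5 : (r+1) * s * A ≤ (r+1) * s * I := by gcongr
    have h6 : s ≤ s * I := Nat.le_mul_of_pos_right _ hI1
    have h7 : s * I ≤ r * (s * I) := Nat.le_mul_of_pos_left _ this
    have h8 : A ≤ s * I := hAI.trans (Nat.le_mul_of_pos_left _ hs)
    nlinarith
  obtain ⟨a, ha, ha0⟩ := Submodule.exists_mem_ne_zero_of_ne_bot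
    (LinearMap.ker_ne_bot_of_finrank_lt (f := Φ) hdim)
  have haB : ∑ e : ι, C (a e) * B e = 0 := by
    have h := congrArg Subtype.val (LinearMap.mem_ker.1 ha)
    simpa [Φ, LinearMap.sum_apply, smul_eq_C_mul] using h
  have hroot : ∀ e : ι, ∃ b : K, b ^ (q * A) = a e := by
    intro e
    obtain ⟨b, hb⟩ := IsAlgClosed.exists_pow_nat_eq (a e) (n := q * A) (by positivity)
    exact ⟨b, hb⟩
  choose b hb using hroot
  let E : ι → K[X] := fun e => C (b e) * (X ^ (e.1.1 + e.2.1.1 * (q * I)) * v ^ e.2.2.1)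
  have hEdeg : ∀ e, b e ≠ 0 → (E e).natDegree = e.1.1 + e.2.1.1 * (q * I) + e.2.2.1 * (s * I) := by
    intro e he
    simp only [E]
    rw [natDegree_C_mul he, natDegree_mul (pow_ne_zero _ X_ne_zero) (pow_ne_zero _ hv0),
      natDegree_X_pow, natDegree_pow, hvdeg]
  have hE0 : ∀ e, E e ≠ 0 ↔ b e ≠ 0 := by
    intro e
    simp [E, hv0, pow_ne_zero]
  set H : K[X] := ∑ e, E e with hH
  have hdisj : {i | i ∈ (Finset.univ : Finset ι) ∧ E i ≠ 0}.Pairwise (Function.onFun Ne (degree ∘ E)) := by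
    rintro e ⟨-, he⟩ e' ⟨-, he'⟩ hne h
    apply hne
    simp only [Function.comp] at h
    have h := natDegree_eq_of_degree_eq h
    rw [hEdeg e ((hE0 e).1 he), hEdeg e' ((hE0 e').1 he')] at h
    obtain ⟨h1, h2, h3⟩ := step_inj q s I hI1 hcop _ _ _ _ _ _ e.1.2 e'.1.2 e.2.2.2 e'.2.2.2 h
    exact Prod.ext (Fin.ext h1) (Prod.ext (Fin.ext h2) (Fin.ext h3))
  have hHne : H ≠ 0 := by
    intro h
    have h1 := degree_sum_eq_of_disjoint E Finset.univ hdisj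
    rw [← hH, h, degree_zero] at h1
    apply ha0
    funext e
    have h2 : (E e).degree ≤ ⊥ := by rw [h1]; exact Finset.le_sup (f := fun i => (E i).degree) (Finset.mem_univ e)
    have h3 : E e = 0 := degree_eq_bot.1 (le_bot_iff.1 h2)
    have h4 : b e = 0 := by by_contra h; exact ((hE0 e).2 h) h3
    rw [← hb e, h4, zero_pow (by positivity)]; rfl
  have hHdeg : H.natDegree ≤ I + J * (q * I) + q * (s * I) := by
    apply natDegree_sum_le_of_forall_le
    intro e _
    by_cases he : b e = 0
    · simp [E, he]
    · rw [hEdeg e he]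
      gcongr
      · exact e.1.2.le
      · exact e.2.1.2.le
      · exact e.2.2.2.le
  have hqA : q * A = p ^ (m * (μ+1)) := by rw [hA, pow_mul, ← hqp, pow_succ, mul_comm]
  have hZH : ∀ x ∈ Z, H.eval x = 0 := by
    intro x hx
    obtain ⟨hx1, hx2⟩ := hZ x hx
    have hvu : v.eval x ^ (q * A) = t - u.eval x := by
      rw [← hx2, Finset.sum_range_add _ (μ+1), hu, hv]
      simp only [eval_finsetSum, eval_pow, add_sub_cancel_left]
      rw [hqA, sum_pow_char_pow, ← hqA]
      refine Finset.sum_congr rfl fun i _ => ?_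
      rw [← pow_mul]
      congr 1
      rw [hA]; ring
    have h1 : H.eval x ^ (q * A) = 0 := by
      have h2 : eval x (∑ e : ι, C (a e) * B e) = 0 := by rw [haB, eval_zero]
      rw [← h2, hH, eval_finsetSum, eval_finsetSum, hqA, sum_pow_char_pow, ← hqA]
      refine Finset.sum_congr rfl fun e _ => ?_
      simp only [E, B, eval_mul, eval_C, eval_pow, eval_X, eval_sub]
      rw [mul_pow, hb, mul_pow, ← pow_mul (eval x v), mul_comm e.2.2.1, pow_mul (eval x v), hvu,
        ← pow_mul, add_mul, pow_add, pow_add]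
      congr 3
      rw [mul_assoc, mul_comm, pow_mul, show q * I * (q * A) = q ^ (μ + 1 + (ν + 1)) by rw [hI, hA]; ring, hx1]
    exact pow_eq_zero_iff (by positivity) |>.1 h1
  have hcard : Z.card ≤ H.natDegree := by
    refine le_trans ?_ H.card_roots'
    refine Multiset.card_le_card ((Multiset.le_iff_subset Z.nodup).2 fun x hx => ?_)
    exact (mem_roots hHne).2 (hZH x hx)
  refine (hcard.trans hHdeg).trans ?_
  have : q ^ (μ + 1 + ν) = A * (q * I) := by rw [hA, hI]; ring
  rw [this, hJ, pow_succ, ← hI]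
  nlinarith [Nat.le_mul_of_pos_right I (show 0 < q by omega)]

noncomputable def wps {K : Type*} [Field K] (g : K[X]) : PowerSeries K :=
  PowerSeries.C (g.natDegree : K) -
    PowerSeries.X * PowerSeries.derivative K (g.reverse : PowerSeries K) * (g.reverse : PowerSeries K)⁻¹

noncomputable def wlam {K : Type*} [Field K] (f g : K[X]) : K :=
  ∑ k ∈ Finset.range (f.natDegree + 1), f.coeff k * PowerSeries.coeff k (wps g)

lemma wrev_const {K : Type*} [Field K] {g : K[X]} (hg : g.Monic) :
    PowerSeries.constantCoeff (g.reverse : PowerSeries K) = 1 := by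
  rw [Polynomial.constantCoeff_coe, coeff_zero_reverse, hg.leadingCoeff]

lemma wrev_ne {K : Type*} [Field K] {g : K[X]} (hg : g.Monic) :
    (g.reverse : PowerSeries K) ≠ 0 := by
  intro h
  have := wrev_const hg
  rw [h] at this; simp at this

lemma wrev_inv {K : Type*} [Field K] {g : K[X]} (hg : g.Monic) :
    (g.reverse : PowerSeries K) * (g.reverse : PowerSeries K)⁻¹ = 1 :=
  PowerSeries.mul_inv_cancel _ (by rw [wrev_const hg]; exact one_ne_zero)

lemma wps_mul {K : Type*} [Field K] {g h : K[X]} (hg : g.Monic) (hh : h.Monic) :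
    wps (g * h) = wps g + wps h := by
  simp only [wps]
  rw [reverse_mul_of_domain, Polynomial.coe_mul, PowerSeries.mul_inv_rev, Derivation.leibniz,
    hg.natDegree_mul hh]
  have h1 := wrev_inv hg
  have h2 := wrev_inv hh
  simp only [smul_eq_mul, Nat.cast_add, map_add]
  linear_combination (-PowerSeries.X * PowerSeries.derivative K (h.reverse : PowerSeries K) * (h.reverse : PowerSeries K)⁻¹) * h1 + (- PowerSeries.X * PowerSeries.derivative K (g.reverse : PowerSeries K) * (g.reverse : PowerSeries K)⁻¹) * h2

lemma wlam_mul {K : Type*} [Field K] (f : K[X]) {g h : K[X]} (hg : g.Monic) (hh : h.Monic) :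
    wlam f (g * h) = wlam f g + wlam f h := by
  simp only [wlam, wps_mul hg hh, map_add, mul_add, Finset.sum_add_distrib]

lemma wlam_one {K : Type*} [Field K] (f : K[X]) : wlam f 1 = 0 := by
  have := wlam_mul f (monic_one (R := K)) monic_one
  simpa using this

lemma wlam_pow {K : Type*} [Field K] (f : K[X]) {g : K[X]} (hg : g.Monic) (k : ℕ) :
    wlam f (g ^ k) = k * wlam f g := by
  induction k with
  | zero => simp [wlam_one]
  | succ k ih => rw [pow_succ, wlam_mul f (hg.pow k) hg, ih]; push_cast; ring

lemma wrev_X_sub_C {K : Type*} [Field K] (a : K) : (X - C a : K[X]).reverse = 1 - C a * X := by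
  ext n
  rw [coeff_reverse, natDegree_X_sub_C]
  rcases n with _ | _ | n
  · simp [revAt_le, coeff_X_one, coeff_C]
  · simp [revAt_le, coeff_one]
  · rw [revAt_eq_self_of_lt (by omega)]
    simp [coeff_X, coeff_C, coeff_one]

lemma wps_X_sub_C {K : Type*} [Field K] (a : K) (k : ℕ) :
    PowerSeries.coeff k (wps (X - C a)) = a ^ k := by
  have h : wps (X - C a) * (1 - PowerSeries.C a * PowerSeries.X) = 1 := by
    have h1 := wrev_inv (monic_X_sub_C a)
    rw [wps]
    rw [wrev_X_sub_C] at *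
    rw [natDegree_X_sub_C]
    simp only [Polynomial.coe_sub, Polynomial.coe_one, Polynomial.coe_mul, Polynomial.coe_C, Polynomial.coe_X] at h1 ⊢
    have hd : PowerSeries.derivative K (1 - PowerSeries.C a * PowerSeries.X) = - PowerSeries.C a := by
      rw [map_sub, Derivation.leibniz]
      simp
    rw [hd]
    simp only [Nat.cast_one, map_one]
    linear_combination (PowerSeries.X * PowerSeries.C a) * h1
  have h2 : wps (X - C a) = PowerSeries.mk (fun k => a ^ k) := by
    have h3 : PowerSeries.mk (fun k => a ^ k) * (1 - PowerSeries.C a * PowerSeries.X) = 1 := by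
      ext n
      rw [mul_sub, mul_one, ← mul_assoc, map_sub]
      rcases n with _ | n
      · simp
      · simp [PowerSeries.coeff_succ_mul_X, PowerSeries.coeff_mul_C, pow_succ, PowerSeries.coeff_one]
    have h4 : (1 - PowerSeries.C a * PowerSeries.X : PowerSeries K) ≠ 0 := by
      intro h; rw [h] at h3; simp at h3
    exact mul_right_cancel₀ h4 (h.trans h3.symm)
  rw [h2, PowerSeries.coeff_mk]

lemma wlam_X_sub_C {K : Type*} [Field K] (f : K[X]) (a : K) : wlam f (X - C a) = f.eval a := by
  simp only [wlam, wps_X_sub_C, eval_eq_sum_range]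

lemma wlam_prod {K : Type*} [Field K] (f : K[X]) (T : Multiset K) :
    wlam f (T.map (fun a => X - C a)).prod = (T.map (fun a => f.eval a)).sum := by
  induction T using Multiset.induction with
  | empty => simp [wlam_one]
  | cons a T ih =>
    rw [Multiset.map_cons, Multiset.prod_cons, wlam_mul f (monic_X_sub_C a)
      (monic_multiset_prod_of_monic _ _ fun a _ => monic_X_sub_C a), ih, wlam_X_sub_C]
    simp

lemma wlam_map {K L : Type*} [Field K] [Field L] (i : K →+* L) (f : K[X]) {g : K[X]} (hg : g.Monic) :
    wlam (f.map i) (g.map i) = i (wlam f g) := by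
  have hr : (g.map i).reverse = g.reverse.map i := by
    ext n
    simp [coeff_reverse, natDegree_map]
  have hr2 : ((g.map i).reverse : PowerSeries L) = PowerSeries.map i (g.reverse : PowerSeries K) := by
    rw [hr]; ext n; simp
  have hinv : ((g.map i).reverse : PowerSeries L)⁻¹ = PowerSeries.map i ((g.reverse : PowerSeries K)⁻¹) := by
    have h1 := wrev_inv (hg.map i)
    have h2 := congrArg (PowerSeries.map i) (wrev_inv hg)
    rw [map_mul, ← hr2, map_one] at h2
    exact mul_left_cancel₀ (wrev_ne (hg.map i)) (h1.trans h2.symm)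
  have hps : wps (g.map i) = PowerSeries.map i (wps g) := by
    rw [wps, hinv, wps, map_sub, map_mul, map_mul, hr2, natDegree_map]
    congr 1
    · simp
    · congr 1
      congr 1
      · simp
      · ext n
        simp [PowerSeries.coeff_derivative]
  simp only [wlam, hps, natDegree_map, coeff_map, PowerSeries.coeff_map, map_sum, map_mul]

lemma wlam_shift {K : Type*} [Field K] (f : K[X]) (s : ℕ) (hf : f.natDegree = s) (hs : 1 ≤ s)
    {g : K[X]} (hg : g.Monic) (d : ℕ) (hd : g.natDegree = d) (hsd : s ≤ d) (b : K) :
    wlam f (g + C b * X ^ (d - s)) = wlam f g - s * f.coeff s * b := by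
  have hlt : (C b * X ^ (d - s) : K[X]).degree < g.degree := by
    rw [degree_eq_natDegree hg.ne_zero, hd]
    refine (degree_C_mul_X_pow_le _ _).trans_lt ?_
    exact_mod_cast (by omega : d - s < d)
  have hg2 : (g + C b * X ^ (d - s)).Monic := hg.add_of_left hlt
  have hd2 : (g + C b * X ^ (d - s)).natDegree = d := by
    rw [natDegree_eq_of_degree_eq (degree_add_eq_left_of_degree_lt hlt), hd]
  have hrev : (g + C b * X ^ (d - s)).reverse = g.reverse + C b * X ^ s := by
    ext n
    rw [coeff_reverse, coeff_add, coeff_add, coeff_reverse, hd2, hd, coeff_C_mul_X_pow, coeff_C_mul_X_pow]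
    congr 1
    by_cases hn : n ≤ d
    · rw [revAt_le hn]
      by_cases h : n = s
      · simp [h]
      · rw [if_neg (by omega), if_neg h]
    · rw [revAt_eq_self_of_lt (by omega), if_neg (by omega), if_neg (by omega)]
  have h1 := wrev_inv hg
  have h2 := wrev_inv hg2
  set g2 := g + C b * X ^ (d - s) with hg2def
  set r := (g.reverse : PowerSeries K) with hr
  set r2 := (g2.reverse : PowerSeries K) with hr2
  have e2 : r2 = r + PowerSeries.C b * PowerSeries.X ^ s := by
    rw [hr2, hrev]; simp [hr]
  obtain ⟨s', rfl⟩ : ∃ s', s = s' + 1 := ⟨s - 1, by omega⟩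
  have hps : wps g2 = wps g + PowerSeries.X ^ (s'+1) *
      (PowerSeries.C b * (PowerSeries.X * PowerSeries.derivative K r - ((s'+1 : ℕ) : PowerSeries K) * r) * (r⁻¹ * r2⁻¹)) := by
    rw [wps, wps, hd2, hd, ← hr, ← hr2]
    have hder : PowerSeries.derivative K r2 = PowerSeries.derivative K r + PowerSeries.C b * (((s'+1 : ℕ) : PowerSeries K) * PowerSeries.X ^ s') := by
      rw [e2, map_add, Derivation.leibniz, Derivation.leibniz_pow]
      simp
    rw [hder]
    set D := PowerSeries.derivative K r
    have e3 : PowerSeries.C b * PowerSeries.X ^ (s'+1) = r2 - r := by rw [e2]; ring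
    have e4 : r⁻¹ - r2⁻¹ = (r2 - r) * r⁻¹ * r2⁻¹ := by
      linear_combination (- r⁻¹) * h2 + r2⁻¹ * h1
    rw [← e3] at e4
    rw [pow_succ] at *
    linear_combination (PowerSeries.X * D) * e4 + (PowerSeries.X ^ s' * PowerSeries.X * PowerSeries.C b * ((s'+1 : ℕ) : PowerSeries K) * r2⁻¹) * h1
  simp only [wlam, hps, map_add, mul_add, Finset.sum_add_distrib, hf]
  rw [sub_eq_add_neg (Finset.sum _ _)]
  congr 1
  rw [Finset.sum_range_succ, Finset.sum_eq_zero, zero_add]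
  · have : PowerSeries.coeff (s'+1) (PowerSeries.X ^ (s'+1) *
      (PowerSeries.C b * (PowerSeries.X * PowerSeries.derivative K r - ((s'+1 : ℕ) : PowerSeries K) * r) * (r⁻¹ * r2⁻¹))) = - ((s'+1 : ℕ) : K) * b := by
      have := PowerSeries.coeff_X_pow_mul (PowerSeries.C b * (PowerSeries.X * PowerSeries.derivative K r - ((s'+1 : ℕ) : PowerSeries K) * r) * (r⁻¹ * r2⁻¹)) (s'+1) 0
      rw [zero_add] at this
      rw [this, PowerSeries.coeff_zero_eq_constantCoeff]
      have c1 := wrev_const hg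
      have c2 := wrev_const hg2
      rw [← hr] at c1; rw [← hr2] at c2
      simp only [map_mul, map_sub, PowerSeries.constantCoeff_inv, c1, c2]
      simp
      ring
    rw [this]; ring
  · intro k hk
    rw [PowerSeries.coeff_X_pow_mul', if_neg (by simpa using hk), mul_zero]

lemma wM_finite (F : Type*) [Field F] [Finite F] (d : ℕ) :
    {g : F[X] | g.Monic ∧ g.natDegree = d}.Finite := by
  have e := (monicEquivDegreeLT (R := F) d).trans (degreeLTEquiv F d).toEquiv
  have : Finite {p : F[X] // p.Monic ∧ p.natDegree = d} := Finite.of_equiv _ e.symm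
  exact Set.finite_coe_iff.1 this

noncomputable def wM (F : Type*) [Field F] [Finite F] (d : ℕ) : Finset F[X] :=
  (wM_finite F d).toFinset

lemma mem_wM {F : Type*} [Field F] [Finite F] {d : ℕ} {g : F[X]} :
    g ∈ wM F d ↔ g.Monic ∧ g.natDegree = d := by
  simp [wM]

lemma wT_finite (F : Type*) [Field F] [Finite F] (n : ℕ) :
    {a : F[X] × ℕ | a.1.Monic ∧ Irreducible a.1 ∧ 1 ≤ a.2 ∧ a.1.natDegree * a.2 = n}.Finite := by
  refine Set.Finite.subset (((Set.finite_Iic n).biUnion (fun d _ => wM_finite F d)).prod (Set.finite_Iic n)) ?_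
  rintro ⟨P, k⟩ ⟨h1, h2, h3, h4⟩
  have := h2.natDegree_pos
  simp only [Set.mem_prod, Set.mem_iUnion, Set.mem_Iic, Set.mem_ofPred_eq] at *
  refine ⟨⟨P.natDegree, ?_, h1, rfl⟩, ?_⟩ <;> nlinarith

noncomputable def wT (F : Type*) [Field F] [Finite F] (n : ℕ) : Finset (F[X] × ℕ) :=
  (wT_finite F n).toFinset

lemma mem_wT {F : Type*} [Field F] [Finite F] {n : ℕ} {a : F[X] × ℕ} :
    a ∈ wT F n ↔ a.1.Monic ∧ Irreducible a.1 ∧ 1 ≤ a.2 ∧ a.1.natDegree * a.2 = n := by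
  simp [wT]

open Classical in
lemma wdeg {F : Type*} [Field F] [Finite F] (D : ℕ) (g : F[X]) (hg : g ∈ wM F D) :
    ∑ n ∈ Finset.Icc 1 D, ∑ a ∈ wT F n, (if a.1 ^ a.2 ∣ g then a.1.natDegree else 0) = D := by
  obtain ⟨hgm, hgd⟩ := mem_wM.1 hg
  have hg0 := hgm.ne_zero
  set N := UniqueFactorizationMonoid.normalizedFactors g with hN
  have hNmem : ∀ P ∈ N, P.Monic ∧ Irreducible P := by
    intro P hP
    have hi := UniqueFactorizationMonoid.irreducible_of_normalized_factor P hP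
    have hn := UniqueFactorizationMonoid.normalize_normalized_factor P hP
    refine ⟨?_, hi⟩
    rw [← hn]; exact monic_normalize hi.ne_zero
  have hNiff : ∀ P : F[X], P.Monic → Irreducible P → ∀ k, P ^ k ∣ g ↔ k ≤ N.count P := by
    intro P hP hi k
    rw [pow_dvd_iff_le_emultiplicity,
      UniqueFactorizationMonoid.emultiplicity_eq_count_normalizedFactors hi hg0, hP.normalize_eq_self]
    simp [hN]
  have hprod : N.prod = g := by
    refine eq_of_monic_of_associated ?_ hgm (UniqueFactorizationMonoid.prod_normalizedFactors hg0)
    have := monic_multiset_prod_of_monic N (fun P => P) fun P hP => (hNmem P hP).1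
    simpa using this
  have hsum : ∑ P ∈ N.toFinset, N.count P * P.natDegree = D := by
    rw [← hgd]
    conv_rhs => rw [← hprod]
    rw [natDegree_multiset_prod_of_monic _ (fun P hP => (hNmem P hP).1), Finset.sum_multiset_map_count]
    simp
  have hle : ∀ P k, P.Monic → Irreducible P → P ^ k ∣ g → P.natDegree * k ≤ D := by
    intro P k hP hi hd
    have := natDegree_le_of_dvd hd hg0
    rwa [natDegree_pow, hgd, mul_comm] at this
  let B : Finset (F[X] × ℕ) := (N.toFinset ×ˢ Finset.Icc 1 D).filter (fun a => a.1 ^ a.2 ∣ g)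
  have hB : ∑ a ∈ B, a.1.natDegree = D := by
    rw [← hsum, Finset.sum_filter, Finset.sum_product]
    refine Finset.sum_congr rfl fun P hP => ?_
    obtain ⟨hPm, hPi⟩ := hNmem P (Multiset.mem_toFinset.1 hP)
    dsimp only
    rw [← Finset.sum_filter, Finset.sum_const, smul_eq_mul]
    congr 1
    have : (Finset.Icc 1 D).filter (fun k => P ^ k ∣ g) = Finset.Icc 1 (N.count P) := by
      ext k
      simp only [Finset.mem_filter, Finset.mem_Icc, hNiff P hPm hPi]
      refine ⟨fun h => ⟨h.1.1, h.2⟩, fun h => ⟨⟨h.1, ?_⟩, h.2⟩⟩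
      have := hle P k hPm hPi ((hNiff P hPm hPi k).2 h.2)
      have := hPi.natDegree_pos
      nlinarith
    rw [this]; simp
  have hmap : ∀ a ∈ B, a.1.natDegree * a.2 ∈ Finset.Icc 1 D := by
    intro a ha
    simp only [B, Finset.mem_filter, Finset.mem_product, Multiset.mem_toFinset, Finset.mem_Icc] at ha
    obtain ⟨hPm, hPi⟩ := hNmem _ ha.1.1
    rw [Finset.mem_Icc]
    exact ⟨Nat.mul_pos hPi.natDegree_pos ha.1.2.1, hle _ _ hPm hPi ha.2⟩
  refine Eq.trans ?_ ((Finset.sum_fiberwise_of_maps_to hmap _).trans hB)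
  refine Finset.sum_congr rfl fun n hn => ?_
  rw [← Finset.sum_filter]
  refine Finset.sum_congr ?_ fun _ _ => rfl
  ext a
  simp only [B, Finset.mem_filter, Finset.mem_product, Multiset.mem_toFinset, Finset.mem_Icc, mem_wT]
  constructor
  · rintro ⟨⟨h1, h2, h3, h4⟩, h5⟩
    have h6 := hle _ _ h1 h2 h5
    have h7 := h2.natDegree_pos
    refine ⟨⟨⟨?_, h3, by nlinarith⟩, h5⟩, h4⟩
    rw [← Multiset.one_le_count_iff_mem]
    exact h3.trans ((hNiff _ h1 h2 _).1 h5)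
  · rintro ⟨⟨⟨h1, h2, h3⟩, h4⟩, h5⟩
    exact ⟨⟨(hNmem _ h1).1, (hNmem _ h1).2, h2, h5⟩, h4⟩

open Classical in
lemma wrec {F : Type*} [Field F] [Finite F] (χ : F[X] → ℂ)
    (hmul : ∀ g h : F[X], g.Monic → h.Monic → χ (g * h) = χ g * χ h) (hone : χ 1 = 1) (D : ℕ) :
    (D : ℂ) * ∑ g ∈ wM F D, χ g = ∑ n ∈ Finset.Icc 1 D,
      (∑ a ∈ wT F n, (a.1.natDegree : ℂ) * χ a.1 ^ a.2) * ∑ g ∈ wM F (D - n), χ g := by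
  have hpow : ∀ g : F[X], g.Monic → ∀ k, χ (g ^ k) = χ g ^ k := by
    intro g hg k
    induction k with
    | zero => simp [hone]
    | succ k ih => rw [pow_succ, hmul _ _ (hg.pow k) hg, ih, pow_succ]
  have h1 : ∀ g ∈ wM F D, (D : ℂ) * χ g = ∑ n ∈ Finset.Icc 1 D, ∑ a ∈ wT F n,
      (if a.1 ^ a.2 ∣ g then (a.1.natDegree : ℂ) * χ g else 0) := by
    intro g hg
    have h := congrArg (Nat.cast : ℕ → ℂ) (wdeg D g hg)
    push_cast at h
    rw [← h, Finset.sum_mul]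
    refine Finset.sum_congr rfl fun n _ => ?_
    rw [Finset.sum_mul]
    refine Finset.sum_congr rfl fun a _ => ?_
    rw [ite_mul, zero_mul]
  rw [Finset.mul_sum, Finset.sum_congr rfl h1, Finset.sum_comm]
  refine Finset.sum_congr rfl fun n hn => ?_
  rw [Finset.sum_comm, Finset.sum_mul]
  refine Finset.sum_congr rfl fun a ha => ?_
  obtain ⟨am, ai, a1, an⟩ := mem_wT.1 ha
  rw [← Finset.sum_filter, ← Finset.mul_sum, mul_assoc, ← hpow _ am]
  congr 1
  rw [Finset.mul_sum]
  symm
  have hPk := am.pow a.2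
  have hnD := (Finset.mem_Icc.1 hn).2
  have hdk : (a.1 ^ a.2).natDegree = n := by rw [natDegree_pow, mul_comm, an]
  refine Finset.sum_bij (fun h _ => a.1 ^ a.2 * h) ?_ ?_ ?_ ?_
  · intro h hh
    obtain ⟨hm, hd⟩ := mem_wM.1 hh
    rw [Finset.mem_filter, mem_wM]
    refine ⟨⟨hPk.mul hm, ?_⟩, dvd_mul_right _ _⟩
    rw [hPk.natDegree_mul hm, hdk, hd]; omega
  · intro h _ h' _ he
    exact mul_left_cancel₀ hPk.ne_zero he
  · intro g hg
    rw [Finset.mem_filter, mem_wM] at hg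
    obtain ⟨⟨gm, gd⟩, h, rfl⟩ := hg
    have hm : h.Monic := hPk.of_mul_monic_left gm
    refine ⟨h, mem_wM.2 ⟨hm, ?_⟩, rfl⟩
    rw [hPk.natDegree_mul hm, hdk] at gd; omega
  · intro h hh
    rw [hmul _ _ hPk (mem_wM.1 hh).1]

lemma wvanish {F : Type*} [Field F] [Finite F] (ψ : AddChar F ℂ) (hψ : ψ ≠ 1) (f : F[X]) (s : ℕ)
    (hf : f.natDegree = s) (hs : 1 ≤ s) (hsF : (s : F) ≠ 0) (d : ℕ) (hd : s ≤ d) :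
    ∑ g ∈ wM F d, ψ (wlam f g) = 0 := by
  obtain ⟨x, hx⟩ := (AddChar.ne_one_iff).1 hψ
  have hlc : f.coeff s ≠ 0 := by
    rw [← hf]; apply leadingCoeff_ne_zero.2; rintro rfl; simp at hf; omega
  let b : F := - x / (s * f.coeff s)
  have hb : s * f.coeff s * b = - x := by simp only [b]; field_simp
  have hmem : ∀ (b : F), ∀ g ∈ wM F d, g + C b * X ^ (d - s) ∈ wM F d := by
    intro b g hg
    obtain ⟨hm, hd'⟩ := mem_wM.1 hg
    have hlt : (C b * X ^ (d - s) : F[X]).degree < g.degree := by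
      rw [degree_eq_natDegree hm.ne_zero, hd']
      refine (degree_C_mul_X_pow_le _ _).trans_lt ?_
      exact_mod_cast (by omega : d - s < d)
    refine mem_wM.2 ⟨hm.add_of_left hlt, ?_⟩
    rw [natDegree_eq_of_degree_eq (degree_add_eq_left_of_degree_lt hlt), hd']
  have key : ∑ g ∈ wM F d, ψ (wlam f g) = ψ x * ∑ g ∈ wM F d, ψ (wlam f g) := by
    rw [Finset.mul_sum]
    symm
    refine Finset.sum_bij' (fun g _ => g + C b * X ^ (d - s)) (fun g _ => g + C (-b) * X ^ (d - s))
      (fun g hg => hmem b g hg) (fun g hg => hmem (-b) g hg) ?_ ?_ ?_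
    · intro g _; simp
    · intro g _; simp
    · intro g hg
      obtain ⟨hm, hd'⟩ := mem_wM.1 hg
      rw [wlam_shift f s hf hs hm d hd' hd b, hb, ← AddChar.map_add_eq_mul]
      congr 1; ring
  have h2 : (1 - ψ x) * ∑ g ∈ wM F d, ψ (wlam f g) = 0 := by linear_combination key
  rcases mul_eq_zero.1 h2 with h | h
  · exact absurd (by linear_combination -h) hx
  · exact h

lemma wc_zero {F : Type*} [Field F] [Finite F] (ψ : AddChar F ℂ) (f : F[X]) :
    ∑ g ∈ wM F 0, ψ (wlam f g) = 1 := by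
  have : wM F 0 = {1} := by
    ext g
    rw [mem_wM, Finset.mem_singleton]
    constructor
    · rintro ⟨h1, h2⟩; exact h1.natDegree_eq_zero.1 h2
    · rintro rfl; exact ⟨monic_one, natDegree_one⟩
  rw [this, Finset.sum_singleton, wlam_one, AddChar.map_zero_eq_one]

lemma wc_one {F : Type*} [Field F] [Fintype F] (ψ : AddChar F ℂ) (f : F[X]) :
    ∑ g ∈ wM F 1, ψ (wlam f g) = ∑ z : F, ψ (f.eval z) := by
  symm
  refine Finset.sum_bij (fun z _ => X - C z) ?_ ?_ ?_ ?_
  · intro z _; exact mem_wM.2 ⟨monic_X_sub_C z, natDegree_X_sub_C z⟩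
  · intro z _ z' _ h; simpa using h
  · intro g hg
    obtain ⟨hm, hd⟩ := mem_wM.1 hg
    refine ⟨- g.coeff 0, Finset.mem_univ _, ?_⟩
    have := hm.eq_X_add_C hd
    rw [this]; simp
  · intro z _; rw [wlam_X_sub_C]

section WeilConj
variable {F : Type*} [Field F] [Fintype F]


lemma wpow_map (f : F[X]) (i : ℕ) (x : AlgebraicClosure F) :
    aeval (x ^ Fintype.card F ^ i) f = (aeval x f) ^ Fintype.card F ^ i := by
  induction i with
  | zero => simp
  | succ i ih =>
    have h := Polynomial.aeval_algHom_apply (FiniteField.frobeniusAlgHom F (AlgebraicClosure F)) (x ^ Fintype.card F ^ i) f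
    simp only [FiniteField.coe_frobeniusAlgHom] at h
    rw [pow_succ, pow_mul, pow_mul, h, ih]

lemma wpow_inj (i : ℕ) {x y : AlgebraicClosure F} (h : x ^ Fintype.card F ^ i = y ^ Fintype.card F ^ i) : x = y := by
  induction i with
  | zero => simpa using h
  | succ i ih =>
    rw [pow_succ, pow_mul, pow_mul] at h
    exact ih ((FiniteField.frobeniusAlgHom F (AlgebraicClosure F)).toRingHom.injective h)

lemma wfix_iff {P : F[X]} (hi : Irreducible P) {x : AlgebraicClosure F}
    (hx : aeval x P = 0) (n : ℕ) : x ^ Fintype.card F ^ n = x ↔ P.natDegree ∣ n := by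
  rw [hi.natDegree_dvd_iff_dvd_X_pow_card_pow_sub_X, Nat.card_eq_fintype_card]
  constructor
  · intro h
    have h1 : aeval x (X ^ Fintype.card F ^ n - X : F[X]) = 0 := by simp [h]
    have h2 := minpoly.dvd F x h1
    have h3 := minpoly.dvd F x hx
    exact ((minpoly.irreducible (Algebra.IsIntegral.isIntegral x)).associated_of_dvd hi h3).dvd_iff_dvd_left.1 h2
  · rintro ⟨Q, hQ⟩
    have h1 : aeval x (X ^ Fintype.card F ^ n - X : F[X]) = 0 := by rw [hQ, map_mul, hx, zero_mul]
    simpa [sub_eq_zero] using h1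

lemma wroots {P : F[X]} (hi : Irreducible P) {x : AlgebraicClosure F}
    (hx : aeval x P = 0) :
    (P.map (algebraMap F (AlgebraicClosure F))).roots =
      (Multiset.range P.natDegree).map (fun i => x ^ Fintype.card F ^ i) := by
  have hP0 : P.map (algebraMap F (AlgebraicClosure F)) ≠ 0 := map_ne_zero hi.ne_zero
  have hlt : ∀ i j, i < j → j < P.natDegree → x ^ Fintype.card F ^ i ≠ x ^ Fintype.card F ^ j := by
    intro i j hij hj h
    have h1 : (x ^ Fintype.card F ^ (j - i)) ^ Fintype.card F ^ i = x ^ Fintype.card F ^ i := by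
      rw [h, ← pow_mul, ← pow_add, Nat.sub_add_cancel hij.le]
    have h2 := (wfix_iff hi hx _).1 (wpow_inj i h1)
    have := Nat.le_of_dvd (by omega) h2
    omega
  have hnd : ((Multiset.range P.natDegree).map (fun i => x ^ Fintype.card F ^ i)).Nodup := by
    refine Multiset.Nodup.map_on ?_ (Multiset.nodup_range _)
    intro i hi' j hj h
    rw [Multiset.mem_range] at hi' hj
    rcases lt_trichotomy i j with h1 | h1 | h1
    · exact absurd h (hlt i j h1 hj)
    · exact h1
    · exact absurd h.symm (hlt j i h1 hi')
  symm
  refine Multiset.eq_of_le_of_card_le ((Multiset.le_iff_subset hnd).2 ?_) ?_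
  · intro y hy
    obtain ⟨i, -, rfl⟩ := Multiset.mem_map.1 hy
    rw [mem_roots hP0, IsRoot, eval_map_algebraMap, wpow_map, hx, zero_pow (by positivity)]
  · refine (card_roots' _).trans ?_
    simp

lemma wlam_conj (f : F[X]) {P : F[X]} (hm : P.Monic) (hi : Irreducible P) {x : AlgebraicClosure F}
    (hx : aeval x P = 0) :
    algebraMap F (AlgebraicClosure F) (wlam f P) =
      ∑ i ∈ Finset.range P.natDegree, (aeval x f) ^ Fintype.card F ^ i := by
  rw [← wlam_map _ _ hm]
  have h := (IsAlgClosed.splits (P.map (algebraMap F (AlgebraicClosure F)))).eq_prod_roots_of_monic (hm.map _)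
  rw [h, wlam_prod, wroots hi hx, Multiset.map_map]
  simp only [Function.comp_def, eval_map_algebraMap, wpow_map]
  rfl

lemma wlam_conj_mul (f : F[X]) {P : F[X]} (hm : P.Monic) (hi : Irreducible P) {x : AlgebraicClosure F}
    (hx : aeval x P = 0) (k : ℕ) :
    algebraMap F (AlgebraicClosure F) (k * wlam f P) =
      ∑ i ∈ Finset.range (P.natDegree * k), (aeval x f) ^ Fintype.card F ^ i := by
  have hfix : ∀ k, (aeval x f) ^ Fintype.card F ^ (P.natDegree * k) = aeval x f := by
    intro k
    rw [← wpow_map, (wfix_iff hi hx _).2 (dvd_mul_right _ _)]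
  induction k with
  | zero => simp
  | succ k ih =>
    rw [Nat.mul_succ, Finset.sum_range_add, ← ih]
    simp only [pow_add, pow_mul _ (Fintype.card F ^ (P.natDegree * k)), hfix]
    rw [← wlam_conj f hm hi hx, ← map_add]
    congr 1
    push_cast; ring

noncomputable def wR (F : Type*) [Field F] [Fintype F] (n : ℕ) : Finset (AlgebraicClosure F) :=
  open Classical in (X ^ Fintype.card F ^ n - X : (AlgebraicClosure F)[X]).roots.toFinset

lemma mem_wR {n : ℕ} (hn : n ≠ 0) {x : AlgebraicClosure F} : x ∈ wR F n ↔ x ^ Fintype.card F ^ n = x := by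
  have := FiniteField.X_pow_card_pow_sub_X_ne_zero (AlgebraicClosure F) hn (Fintype.one_lt_card (α := F))
  simp [wR, mem_roots this, sub_eq_zero]

lemma card_wR {n : ℕ} (hn : n ≠ 0) : (wR F n).card = Fintype.card F ^ n := by
  classical
  obtain ⟨p, hp⟩ := CharP.exists F
  obtain ⟨m, hpp, hm⟩ := FiniteField.card F p
  have : CharP (AlgebraicClosure F) p := charP_of_injective_algebraMap (algebraMap F _).injective p
  have hd : p ∣ Fintype.card F ^ n := by
    rw [hm]; exact dvd_pow (dvd_pow_self _ m.ne_zero) hn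
  have hsep := galois_poly_separable (K := AlgebraicClosure F) p (Fintype.card F ^ n) hd
  rw [wR, Multiset.toFinset_card_of_nodup (nodup_roots hsep), ← (IsAlgClosed.splits _).natDegree_eq_card_roots,
    FiniteField.X_pow_card_pow_sub_X_natDegree_eq _ hn Fintype.one_lt_card]

open Classical in
lemma wS_eq (χ : F[X] → ℂ) (n : ℕ) (hn : n ≠ 0) :
    ∑ a ∈ wT F n, (a.1.natDegree : ℂ) * χ a.1 ^ a.2 =
      ∑ x ∈ wR F n, χ (minpoly F x) ^ (n / (minpoly F x).natDegree) := by
  have hint : ∀ x : AlgebraicClosure F, IsIntegral F x := fun x => Algebra.IsIntegral.isIntegral x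
  have hmap : ∀ x ∈ wR F n, (minpoly F x, n / (minpoly F x).natDegree) ∈ wT F n := by
    intro x hx
    have hirr := minpoly.irreducible (hint x)
    have hd := (wfix_iff hirr (minpoly.aeval F x) n).1 ((mem_wR hn).1 hx)
    refine mem_wT.2 ⟨minpoly.monic (hint x), hirr, ?_, Nat.mul_div_cancel' hd⟩
    exact Nat.div_pos (Nat.le_of_dvd (by omega) hd) hirr.natDegree_pos
  rw [← Finset.sum_fiberwise_of_maps_to hmap]
  refine Finset.sum_congr rfl fun a ha => ?_
  obtain ⟨am, ai, a1, an⟩ := mem_wT.1 ha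
  have hc : ∀ x ∈ (wR F n).filter (fun x => (minpoly F x, n / (minpoly F x).natDegree) = a),
      χ (minpoly F x) ^ (n / (minpoly F x).natDegree) = χ a.1 ^ a.2 := by
    intro x hx
    rw [← (Finset.mem_filter.1 hx).2]
  rw [Finset.sum_congr rfl hc, Finset.sum_const, nsmul_eq_mul]
  congr 2
  obtain ⟨x0, hx0⟩ : ∃ x : AlgebraicClosure F, aeval x a.1 = 0 :=
    IsAlgClosed.exists_aeval_eq_zero _ _ (degree_pos_of_irreducible ai).ne'
  have hP0 : a.1.map (algebraMap F (AlgebraicClosure F)) ≠ 0 := map_ne_zero ai.ne_zero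
  have hset : (wR F n).filter (fun x => (minpoly F x, n / (minpoly F x).natDegree) = a) =
      (a.1.map (algebraMap F (AlgebraicClosure F))).roots.toFinset := by
    ext x
    rw [Finset.mem_filter, Multiset.mem_toFinset, mem_roots hP0, IsRoot, eval_map_algebraMap, mem_wR hn]
    constructor
    · rintro ⟨-, h⟩
      rw [← h]; exact minpoly.aeval F x
    · intro h
      have hmin : minpoly F x = a.1 := (minpoly.eq_of_irreducible_of_monic ai h am).symm
      refine ⟨(wfix_iff ai h n).2 ⟨_, an.symm⟩, ?_⟩
      rw [hmin, ← an, Nat.mul_div_cancel_left _ ai.natDegree_pos]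
  have hsep : (a.1.map (algebraMap F (AlgebraicClosure F))).roots.Nodup :=
    nodup_roots (PerfectField.separable_of_irreducible ai).map
  rw [hset, Multiset.toFinset_card_of_nodup hsep, wroots ai hx0]
  simp

lemma wS_bound (b m : ℕ) (hb : Nat.Prime b)
    (hF : Fintype.card F = b ^ m) (ψ : AddChar F ℂ) (hψ : ψ ≠ 1)
    (f : F[X]) (s : ℕ) (hdeg : f.natDegree = s)
    (hs1 : 1 ≤ s) (hgcd : Nat.Coprime s (b ^ m)) (n : ℕ) :
    ‖∑ a ∈ wT F (n+1), (a.1.natDegree : ℂ) * ψ (wlam f a.1) ^ a.2‖ ≤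
      (2 * b ^ m * ((4 * s + 1) * Real.sqrt (b ^ m))) * Real.sqrt (b ^ m) ^ (n+1) := by
  classical
  set q := Fintype.card F with hq
  have hq2 : 2 ≤ q := Fintype.one_lt_card
  have hcharF : CharP F b := by
    obtain ⟨p, hp⟩ := CharP.exists F
    obtain ⟨k, hpp, hk⟩ := FiniteField.card F p
    have : p = b := by
      have h1 : p ∣ b ^ m := by rw [← hF, hq, hk]; exact dvd_pow_self _ k.ne_zero
      exact (Nat.prime_dvd_prime_iff_eq hpp hb).1 (hpp.dvd_of_dvd_pow h1)
    exact this ▸ hp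
  have hchar : CharP (AlgebraicClosure F) b := charP_of_injective_algebraMap (algebraMap F _).injective b
  have : Fact b.Prime := ⟨hb⟩
  rw [← hF] at hgcd
  have hcast : ((b : ℝ) ^ m) = q := by rw [hF]; push_cast; rfl
  rw [hcast]
  rw [wS_eq (fun g => ψ (wlam f g)) (n+1) (by omega)]
  let τ : AlgebraicClosure F → F := fun x =>
    ((n + 1) / (minpoly F x).natDegree : ℕ) * wlam f (minpoly F x)
  have hτ : ∀ x ∈ wR F (n+1), algebraMap F (AlgebraicClosure F) (τ x) =
      ∑ i ∈ Finset.range (n+1), (aeval x f) ^ q ^ i := by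
    intro x hx
    have hint : IsIntegral F x := Algebra.IsIntegral.isIntegral x
    have hirr := minpoly.irreducible hint
    have hd := (wfix_iff hirr (minpoly.aeval F x) (n+1)).1 ((mem_wR (by omega)).1 hx)
    have := wlam_conj_mul f (minpoly.monic hint) hirr (minpoly.aeval F x) ((n+1) / (minpoly F x).natDegree)
    rw [Nat.mul_div_cancel' hd] at this
    exact this
  have hψτ : ∀ x, ψ (wlam f (minpoly F x)) ^ ((n+1) / (minpoly F x).natDegree) = ψ (τ x) := by
    intro x
    rw [← AddChar.map_nsmul_eq_pow, nsmul_eq_mul]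
  simp only [hψτ]
  let Z : F → Finset (AlgebraicClosure F) := fun t => (wR F (n+1)).filter (fun x => τ x = t)
  have hsum : ∑ x ∈ wR F (n+1), ψ (τ x) = ∑ t : F, ((Z t).card : ℂ) * ψ t := by
    rw [← Finset.sum_fiberwise (wR F (n+1)) τ]
    refine Finset.sum_congr rfl fun t _ => ?_
    rw [Finset.sum_congr rfl (g := fun _ => ψ t) (fun x hx => by rw [(Finset.mem_filter.1 hx).2]),
      Finset.sum_const, nsmul_eq_mul]
  have hZ : ∀ t, (Z t).card ≤ q ^ n + (4 * s + 1) * q ^ (n + 1 - (n + 1) / 2) := by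
    intro t
    rcases Nat.eq_zero_or_pos n with h0 | h0
    · have h1 : (Z t).card ≤ (wR F (n+1)).card := Finset.card_filter_le _ _
      rw [card_wR (by omega)] at h1
      subst h0
      simp only [zero_add, pow_one] at h1 ⊢
      norm_num
      nlinarith
    · obtain ⟨μ, hμ⟩ : ∃ μ, (n + 1) / 2 = μ + 1 := ⟨(n+1)/2 - 1, by omega⟩
      obtain ⟨ν, hν⟩ : ∃ ν, (n + 1) - (n + 1) / 2 = ν + 1 := ⟨(n + 1) - (n+1)/2 - 1, by omega⟩
      have hn : n + 1 = μ + 1 + (ν + 1) := by omega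
      have hn2 : n = μ + 1 + ν := by omega
      have := stepanov b m q hF hq2 (f.map (algebraMap F (AlgebraicClosure F))) s
        (by rw [natDegree_map, hdeg]) hs1 hgcd (algebraMap F (AlgebraicClosure F) t) μ ν (by omega) (Z t) (by
          intro x hx
          obtain ⟨h1, h2⟩ := Finset.mem_filter.1 hx
          rw [← hn]
          refine ⟨(mem_wR (by omega)).1 h1, ?_⟩
          rw [← h2, hτ x h1]
          simp only [eval_map_algebraMap])
      rw [hν, hn2]
      exact this
  set B : ℝ := (4 * s + 1) * (q : ℝ) ^ (n + 1 - (n + 1) / 2) with hB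
  have hZr : ∀ t, ((Z t).card : ℝ) ≤ (q : ℝ) ^ n + B := by
    intro t; rw [hB]; exact_mod_cast hZ t
  have htot : ∑ t : F, ((Z t).card : ℝ) = (q : ℝ) ^ (n + 1) := by
    have h1 := Finset.card_eq_sum_card_fiberwise (f := τ) (s := wR F (n+1)) (t := Finset.univ) (fun _ _ => by simp)
    rw [card_wR (by omega)] at h1
    rw [hq]
    exact_mod_cast h1.symm
  have hψ0 : ∑ t : F, ψ t = 0 := AddChar.sum_eq_zero_of_ne_one hψ
  have hsum2 : ∑ x ∈ wR F (n+1), ψ (τ x) = ∑ t : F, (((Z t).card : ℂ) - (q : ℂ) ^ n) * ψ t := by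
    simp only [sub_mul, Finset.sum_sub_distrib, ← Finset.mul_sum, hψ0, mul_zero, sub_zero]
    exact hsum
  have hB0 : 0 ≤ B := by positivity
  have hmain : ‖∑ x ∈ wR F (n+1), ψ (τ x)‖ ≤ 2 * q * B := by
    rw [hsum2]
    refine (norm_sum_le _ _).trans ?_
    have h1 : ∀ t : F, ‖(((Z t).card : ℂ) - (q : ℂ) ^ n) * ψ t‖ ≤ 2 * B + (q : ℝ) ^ n - (Z t).card := by
      intro t
      rw [norm_mul, AddChar.norm_apply, mul_one]
      have : (((Z t).card : ℂ) - (q : ℂ) ^ n) = (((Z t).card - (q : ℝ) ^ n : ℝ) : ℂ) := by push_cast; rfl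
      rw [this, Complex.norm_real, Real.norm_eq_abs, abs_le]
      have := hZr t
      constructor <;> linarith
    refine (Finset.sum_le_sum fun t _ => h1 t).trans ?_
    rw [Finset.sum_sub_distrib, htot, Finset.sum_const, Finset.card_univ, ← hq, nsmul_eq_mul]
    apply le_of_eq
    ring
  refine hmain.trans ?_
  have hsq : (1:ℝ) ≤ Real.sqrt q := by
    rw [Real.one_le_sqrt]; exact_mod_cast (by omega : 1 ≤ q)
  have hpow : (q : ℝ) ^ (n + 1 - (n + 1) / 2) ≤ Real.sqrt q * Real.sqrt q ^ (n+1) := by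
    rw [← pow_succ']
    conv_lhs => rw [← Real.sq_sqrt (Nat.cast_nonneg q : (0:ℝ) ≤ q), ← pow_mul]
    exact pow_le_pow_right₀ hsq (by omega)
  rw [hB]
  calc 2 * (q : ℝ) * ((4 * s + 1) * (q : ℝ) ^ (n + 1 - (n + 1) / 2))
      ≤ 2 * (q : ℝ) * ((4 * s + 1) * (Real.sqrt q * Real.sqrt q ^ (n+1))) := by gcongr
    _ = _ := by ring

end WeilConj

end

/-- **Weil's bound for exponential sums.** If `F` is a finite field with `q = b ^ m`
elements (`b` prime, `m ≥ 1`), `f` is a nonzero polynomial over `F` of degree `s ≥ 1`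
with `s < q` and `gcd(s, q) = 1`, and `ψ` is a non-trivial additive character of `F`,
then `|∑_{z ∈ F} ψ (f z)| ≤ (s - 1) √q`. -/
theorem stmt_0 (b m : ℕ) (hb : Nat.Prime b) (hm : 1 ≤ m)
    (F : Type) [Field F] [Fintype F] (hF : Fintype.card F = b ^ m)
    (ψ : AddChar F ℂ) (hψ : ψ ≠ 1)
    (f : Polynomial F) (hf : f ≠ 0) (s : ℕ) (hdeg : f.natDegree = s)
    (hs1 : 1 ≤ s) (hsq : s < b ^ m) (hgcd : Nat.gcd s (b ^ m) = 1) :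
    ‖∑ z : F, ψ (f.eval z)‖ ≤ ((s : ℝ) - 1) * Real.sqrt (b ^ m) := by
  have hcop : Nat.Coprime s (b ^ m) := hgcd
  have hq0 : (0:ℝ) < Real.sqrt (b ^ m) := Real.sqrt_pos.2 (pow_pos (by exact_mod_cast hb.pos) m)
  have hsF : (s : F) ≠ 0 := by
    intro h
    have h1 : ((b ^ m : ℕ) : F) = 0 := by rw [← hF]; exact FiniteField.cast_card_eq_zero F
    have h2 := Nat.gcd_eq_gcd_ab s (b ^ m)
    rw [hgcd] at h2
    have h3 := congrArg (Int.cast : ℤ → F) h2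
    simp only [Int.cast_add, Int.cast_mul, Int.cast_natCast, h, h1] at h3
    simp at h3
  have hχ : ∀ g h : Polynomial F, g.Monic → h.Monic →
      ψ (wlam f (g * h)) = ψ (wlam f g) * ψ (wlam f h) := by
    intro g h hg hh
    rw [wlam_mul f hg hh, AddChar.map_add_eq_mul]
  rw [← wc_one ψ f]
  refine weil_analytic (Real.sqrt (b ^ m)) hq0 s hs1 (fun d => ∑ g ∈ wM F d, ψ (wlam f g))
    (fun n => ∑ a ∈ wT F n, (a.1.natDegree : ℂ) * ψ (wlam f a.1) ^ a.2)
    (2 * b ^ m * ((4 * s + 1) * Real.sqrt (b ^ m))) (wc_zero ψ f)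
    (fun d hd => wvanish ψ hψ f s hdeg hs1 hsF d hd)
    (fun n => wS_bound b m hb hF ψ hψ f s hdeg hs1 hcop n) ?_
  intro d
  have h := wrec (fun g => ψ (wlam f g)) hχ (by simp [wlam_one]) (d + 1)
  push_cast at h
  rw [h, Finset.Nat.sum_antidiagonal_eq_sum_range_succ_mk, ← Finset.sum_range_reflect]
  rw [← Finset.Ico_add_one_right_eq_Icc, Finset.sum_Ico_eq_sum_range]
  refine Finset.sum_congr (by simp) fun i hi => ?_
  have hi' : i ≤ d := by simp at hi; omega
  dsimp only
  rw [mul_comm, show d + 1 - (1 + i) = d + 1 - 1 - i by omega,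
    show d - (d + 1 - 1 - i) + 1 = 1 + i by omega]
end

section
/- Let 0 < α ≤ 1 and 1 ≤ p ≤ ∞. Let f : ℝ^s → ℂ be one-periodic in each variable with absolutely summable Fourier coefficients ∑_{k ∈ ℤ^s} |f̃(k)| < ∞ and with finite Hölder seminorm |f|_{H_{α,p}} < ∞. Then for every L ∈ ℕ, |∑_{k ∈ ℤ^s \ {0}} f̃(L·k)| ≤ (s^{α/p}/L^α)·|f|_{H_{α,p}}. -/
open scoped BigOperators ENNReal
open MeasureTheory

/-- The `ℓ^p` norm of `h ∈ ℝ^s`, for `p ∈ [1, ∞]` (sup norm when `p = ∞`). -/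
noncomputable def pnorm (p : ℝ≥0∞) {s : ℕ} (h : Fin s → ℝ) : ℝ :=
  if p = ∞ then ⨆ j : Fin s, |h j| else (∑ j : Fin s, |h j| ^ p.toReal) ^ (1 / p.toReal)

/-- The set of Hölder quotients `‖f(x+h) - f(x)‖ / ‖h‖_{ℓ^p}^α` over
`x, x + h ∈ [0,1)^s`, `h ≠ 0`; its supremum is the Hölder seminorm `|f|_{H_{α,p}}`. -/
def ratioSet (s : ℕ) (α : ℝ) (p : ℝ≥0∞) (f : (Fin s → ℝ) → ℂ) : Set ℝ :=
  {r | ∃ x h : Fin s → ℝ, x ∈ Set.pi Set.univ (fun _ : Fin s => Set.Ico (0 : ℝ) 1) ∧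
    x + h ∈ Set.pi Set.univ (fun _ : Fin s => Set.Ico (0 : ℝ) 1) ∧ h ≠ 0 ∧
    r = ‖f (x + h) - f x‖ / pnorm p h ^ α}

/-- The Hölder seminorm `|f|_{H_{α,p}}`. -/
noncomputable def holderSemi (s : ℕ) (α : ℝ) (p : ℝ≥0∞) (f : (Fin s → ℝ) → ℂ) : ℝ :=
  sSup (ratioSet s α p f)

/-- The Fourier coefficient `f̃(k) = ∫_{[0,1]^s} f(x) e^{-2πi k·x} dx`. -/
noncomputable def fcoeff (s : ℕ) (f : (Fin s → ℝ) → ℂ) (k : Fin s → ℤ) : ℂ :=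
  ∫ x in Set.pi Set.univ (fun _ : Fin s => Set.Icc (0 : ℝ) 1),
    f x * Complex.exp (-(2 * (Real.pi : ℂ) * Complex.I) * ∑ j : Fin s, (k j : ℂ) * (x j : ℂ))


lemma holderSemi_nonneg' (s : ℕ) (α : ℝ) (p : ℝ≥0∞) (f : (Fin s → ℝ) → ℂ) :
    0 ≤ holderSemi s α p f := by
  apply Real.sSup_nonneg
  rintro r ⟨x, h, -, -, -, rfl⟩
  refine div_nonneg (norm_nonneg _) (Real.rpow_nonneg ?_ _)
  unfold pnorm
  split_ifs
  · exact Real.iSup_nonneg fun _ => abs_nonneg _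
  · positivity

lemma pnorm_le' (p : ℝ≥0∞) (hp : 1 ≤ p) {s : ℕ} (h : Fin s → ℝ) (δ : ℝ) (hδ : 0 ≤ δ)
    (hh : ∀ j, |h j| ≤ δ) : pnorm p h ≤ (s : ℝ) ^ (1 / p.toReal) * δ := by
  unfold pnorm
  split_ifs with hpt
  · subst hpt
    simp
    exact Real.iSup_le hh hδ
  · have hp0 : 0 < p.toReal := ENNReal.toReal_pos (by rintro rfl; simp at hp) hpt
    have h1 : (∑ j : Fin s, |h j| ^ p.toReal) ≤ s * δ ^ p.toReal := by
      calc _ ≤ ∑ j : Fin s, δ ^ p.toReal :=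
            Finset.sum_le_sum fun j _ => Real.rpow_le_rpow (abs_nonneg _) (hh j) hp0.le
        _ = _ := by simp
    calc _ ≤ ((s : ℝ) * δ ^ p.toReal) ^ (1 / p.toReal) :=
          Real.rpow_le_rpow (Finset.sum_nonneg fun _ _ => by positivity) h1 (by positivity)
      _ = _ := by
          rw [Real.mul_rpow (by positivity) (by positivity), ← Real.rpow_mul hδ,
            mul_one_div_cancel hp0.ne', Real.rpow_one]

lemma pnorm_pos' (p : ℝ≥0∞) {s : ℕ} (h : Fin s → ℝ) (hh : h ≠ 0) : 0 < pnorm p h := by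
  obtain ⟨j, hj⟩ := Function.ne_iff.mp hh
  have hj' : 0 < |h j| := abs_pos.mpr hj
  unfold pnorm
  split_ifs with hpt
  · exact hj'.trans_le (le_ciSup (f := fun j => |h j|) (Set.finite_range _).bddAbove j)
  · apply Real.rpow_pos_of_pos
    exact Finset.sum_pos' (fun _ _ => by positivity) ⟨j, Finset.mem_univ _, by positivity⟩

lemma holder_est (α : ℝ) (hα0 : 0 < α) (p : ℝ≥0∞) (hp : 1 ≤ p)
    (s : ℕ) (f : (Fin s → ℝ) → ℂ) (hH : BddAbove (ratioSet s α p f))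
    (x y : Fin s → ℝ) (hx : x ∈ Set.pi Set.univ (fun _ : Fin s => Set.Ico (0 : ℝ) 1))
    (hy : y ∈ Set.pi Set.univ (fun _ : Fin s => Set.Ico (0 : ℝ) 1))
    (δ : ℝ) (hδ : 0 ≤ δ) (hd : ∀ j, |y j - x j| ≤ δ) :
    ‖f y - f x‖ ≤ (s : ℝ) ^ (α / p.toReal) * δ ^ α * holderSemi s α p f := by
  have h0 := holderSemi_nonneg' s α p f
  by_cases hxy : y = x
  · subst hxy; simp; positivity
  have hne : y - x ≠ 0 := sub_ne_zero.mpr hxy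
  have hpos := pnorm_pos' p _ hne
  have h1 : ‖f y - f x‖ / pnorm p (y - x) ^ α ≤ holderSemi s α p f :=
    le_csSup hH ⟨x, y - x, hx, by simpa using hy, hne, by simp⟩
  rw [div_le_iff₀ (by positivity)] at h1
  refine h1.trans ?_
  rw [mul_comm]
  refine mul_le_mul_of_nonneg_right ?_ h0
  calc _ ≤ ((s : ℝ) ^ (1 / p.toReal) * δ) ^ α :=
        Real.rpow_le_rpow hpos.le (pnorm_le' p hp _ δ hδ (by simpa using hd)) hα0.le
    _ = _ := by
        rw [Real.mul_rpow (by positivity) hδ, ← Real.rpow_mul (by positivity)]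
        congr 2; ring

lemma holder_cont (α : ℝ) (hα0 : 0 < α) (p : ℝ≥0∞) (hp : 1 ≤ p)
    (s : ℕ) (f : (Fin s → ℝ) → ℂ) (hH : BddAbove (ratioSet s α p f)) :
    ContinuousOn f (Set.pi Set.univ (fun _ : Fin s => Set.Ico (0 : ℝ) 1)) := by
  intro x hx
  rw [ContinuousWithinAt, tendsto_iff_norm_sub_tendsto_zero]
  have key : Filter.Tendsto (fun y : Fin s → ℝ =>
      (s : ℝ) ^ (α / p.toReal) * ‖y - x‖ ^ α * holderSemi s α p f)
      (nhdsWithin x (Set.pi Set.univ (fun _ : Fin s => Set.Ico (0 : ℝ) 1))) (nhds 0) := by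
    have : Continuous (fun y : Fin s → ℝ =>
      (s : ℝ) ^ (α / p.toReal) * ‖y - x‖ ^ α * holderSemi s α p f) := by
      refine (continuous_const.mul (Continuous.rpow_const (by fun_prop) ?_)).mul continuous_const
      intro _; right; exact hα0.le
    have h2 := this.tendsto x
    simp [Real.zero_rpow hα0.ne'] at h2
    exact h2.mono_left nhdsWithin_le_nhds
  refine squeeze_zero' (Filter.Eventually.of_forall fun _ => norm_nonneg _) ?_ key
  filter_upwards [self_mem_nhdsWithin] with y hy
  exact holder_est α hα0 p hp s f hH x y hx hy _ (norm_nonneg _) (fun j => norm_le_pi_norm (y - x) j)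

lemma one_dim (L : ℕ) (hL : 1 ≤ L) (k : ℤ) :
    ∫ x in Set.Icc (0:ℝ) 1, Complex.exp (2 * (Real.pi : ℂ) * Complex.I *
      ((k : ℂ) * (((⌊(L : ℝ) * x⌋ : ℝ) / L : ℝ) : ℂ))) = if (L : ℤ) ∣ k then 1 else 0 := by
  have hL0 : (L : ℂ) ≠ 0 := by exact_mod_cast (by omega : L ≠ 0)
  have hL0' : (L : ℝ) ≠ 0 := by exact_mod_cast (by omega : L ≠ 0)
  split_ifs with hd
  · obtain ⟨m, rfl⟩ := hd
    have : ∀ x : ℝ, Complex.exp (2 * (Real.pi : ℂ) * Complex.I *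
      ((((L : ℤ) * m : ℤ) : ℂ) * (((⌊(L : ℝ) * x⌋ : ℝ) / L : ℝ) : ℂ))) = 1 := by
      intro x
      rw [Complex.exp_eq_one_iff]
      refine ⟨m * ⌊(L : ℝ) * x⌋, ?_⟩
      push_cast
      field_simp
    simp only [this]; simp
  · set h : ℝ → ℂ := fun x => Complex.exp (2 * (Real.pi : ℂ) * Complex.I *
      ((k : ℂ) * (((⌊(L : ℝ) * x⌋ : ℝ) / L : ℝ) : ℂ))) with hh
    have hper : Function.Periodic h 1 := by
      intro x
      have : ⌊(L : ℝ) * (x + 1)⌋ = ⌊(L : ℝ) * x⌋ + L := by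
        rw [mul_add, mul_one]; exact_mod_cast Int.floor_add_natCast _ _
      simp only [hh, this]
      rw [Complex.exp_eq_exp_iff_exists_int]
      refine ⟨k, ?_⟩
      push_cast
      field_simp
    have hshift : ∀ x, h (x + 1 / L) = Complex.exp (2 * (Real.pi : ℂ) * Complex.I * (k / L)) * h x := by
      intro x
      have : ⌊(L : ℝ) * (x + 1 / L)⌋ = ⌊(L : ℝ) * x⌋ + 1 := by
        rw [mul_add, mul_one_div_cancel hL0']; exact Int.floor_add_one _
      simp only [hh, this]
      rw [← Complex.exp_add]
      congr 1
      push_cast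
      field_simp
      ring
    have e1 : ∫ x in Set.Icc (0:ℝ) 1, h x = ∫ x in (0:ℝ)..1, h x := by
      rw [intervalIntegral.integral_of_le zero_le_one, integral_Icc_eq_integral_Ioc]
    have e2 : ∫ x in (0:ℝ)..1, h (x + 1 / L) = ∫ x in (0:ℝ)..1, h x := by
      rw [intervalIntegral.integral_comp_add_right]
      have := hper.intervalIntegral_add_eq (0 + 1 / L) 0
      rw [zero_add (1:ℝ)] at this
      rw [← this]; congr 1; ring
    simp only [hshift, intervalIntegral.integral_const_mul] at e2
    rw [e1]
    have hne : Complex.exp (2 * (Real.pi : ℂ) * Complex.I * (k / L)) ≠ 1 := by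
      rw [Ne, Complex.exp_eq_one_iff]
      rintro ⟨n, hn⟩
      apply hd
      refine ⟨n, ?_⟩
      have hpi : (2 * (Real.pi : ℂ) * Complex.I) ≠ 0 := Complex.two_pi_I_ne_zero
      rw [mul_comm (n : ℂ)] at hn
      have := mul_left_cancel₀ hpi hn
      field_simp at this
      exact_mod_cast this
    have : (Complex.exp (2 * (Real.pi : ℂ) * Complex.I * (k / L)) - 1) * ∫ x in (0:ℝ)..1, h x = 0 := by
      rw [sub_mul, one_mul, e2, sub_self]
    exact (mul_eq_zero.mp this).resolve_left (sub_ne_zero.mpr hne)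

lemma multi_dim (s : ℕ) (L : ℕ) (hL : 1 ≤ L) (k : Fin s → ℤ) :
    ∫ x in Set.pi Set.univ (fun _ : Fin s => Set.Icc (0 : ℝ) 1),
      Complex.exp (2 * (Real.pi : ℂ) * Complex.I *
      ∑ j, (k j : ℂ) * (((⌊(L : ℝ) * x j⌋ : ℝ) / L : ℝ) : ℂ)) =
      if ∀ j, (L : ℤ) ∣ k j then 1 else 0 := by
  simp_rw [Finset.mul_sum, Complex.exp_sum]
  rw [volume_pi, Measure.restrict_pi_pi, integral_fintype_prod_eq_prod (fun j (x : ℝ) =>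
    Complex.exp (2 * (Real.pi : ℂ) * Complex.I *
      ((k j : ℂ) * (((⌊(L : ℝ) * x⌋ : ℝ) / L : ℝ) : ℂ))))]
  simp_rw [one_dim L hL]
  split_ifs with h
  · exact Finset.prod_eq_one fun j _ => by simp [h j]
  · push Not at h
    obtain ⟨j, hj⟩ := h
    exact Finset.prod_eq_zero (Finset.mem_univ j) (by simp [hj])

section torus
open UnitAddTorus

noncomputable local instance instMSCirc : MeasureSpace UnitAddCircle := ⟨AddCircle.haarAddCircle⟩

local instance instHaarCirc : Measure.IsAddHaarMeasure (volume : Measure UnitAddCircle) :=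
  inferInstanceAs (Measure.IsAddHaarMeasure AddCircle.haarAddCircle)

local instance instProbCirc : IsProbabilityMeasure (volume : Measure UnitAddCircle) :=
  inferInstanceAs (IsProbabilityMeasure AddCircle.haarAddCircle)

lemma mFourier_coe (s : ℕ) (k : Fin s → ℤ) (x : Fin s → ℝ) :
    mFourier k (fun i => (x i : UnitAddCircle)) =
      Complex.exp (2 * (Real.pi : ℂ) * Complex.I * ∑ j, (k j : ℂ) * (x j : ℂ)) := by
  simp only [mFourier, ContinuousMap.coe_mk, fourier_coe_apply, Finset.mul_sum, Complex.exp_sum]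
  refine Finset.prod_congr rfl fun j _ => ?_
  congr 1
  push_cast
  ring

lemma cube_Ico_ae (s : ℕ) : (Set.pi Set.univ (fun _ : Fin s => Set.Ico (0 : ℝ) 1)) =ᵐ[volume]
    (Set.pi Set.univ (fun _ : Fin s => Set.Icc (0 : ℝ) 1)) := by
  have := Measure.univ_pi_Ico_ae_eq_Icc (μ := fun _ : Fin s => (volume : Measure ℝ))
    (f := fun _ => (0:ℝ)) (g := fun _ => 1)
  rwa [← Set.pi_univ_Icc] at this

lemma cube_Ioc_ae (s : ℕ) : {x : Fin s → ℝ | ∀ i, x i ∈ Set.Ioc ((fun _ => (0:ℝ)) i) ((fun _ => (0:ℝ)) i + 1)} =ᵐ[volume]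
    (Set.pi Set.univ (fun _ : Fin s => Set.Icc (0 : ℝ) 1)) := by
  have := Measure.univ_pi_Ioc_ae_eq_Icc (μ := fun _ : Fin s => (volume : Measure ℝ))
    (f := fun _ => (0:ℝ)) (g := fun _ => 1)
  rw [← Set.pi_univ_Icc] at this
  have e : {x : Fin s → ℝ | ∀ i, x i ∈ Set.Ioc ((fun _ => (0:ℝ)) i) ((fun _ => (0:ℝ)) i + 1)} =
      Set.pi Set.univ (fun _ : Fin s => Set.Ioc (0 : ℝ) 1) := by
    ext x; simp
  rw [e]
  exact this

lemma fourier_ae (s : ℕ) (f : (Fin s → ℝ) → ℂ) 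
    (hf : MemLp f 2 (volume.restrict (Set.pi Set.univ (fun _ : Fin s => Set.Icc (0 : ℝ) 1))))
    (hsum : Summable fun k : Fin s → ℤ => ‖fcoeff s f k‖) :
    ∀ᵐ x ∂(volume.restrict (Set.pi Set.univ (fun _ : Fin s => Set.Icc (0 : ℝ) 1))),
      f x = ∑' k, fcoeff s f k * Complex.exp (2 * (Real.pi : ℂ) * Complex.I * ∑ j, (k j : ℂ) * (x j : ℂ)) := by
  set a : Fin s → ℝ := fun _ => 0 with ha
  set Q := {x : Fin s → ℝ | ∀ i, x i ∈ Set.Ioc (a i) (a i + 1)} with hQ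
  have hQm : MeasurableSet Q := MeasurableSet.univ_pi' (fun i => measurableSet_Ioc)
  rw [← Measure.restrict_congr_set (cube_Ioc_ae s)] at hf ⊢
  set F : UnitAddTorus (Fin s) → ℂ := fun t => f (measurableEquivPiIoc a t).1 with hF
  have hmp : MeasurePreserving (fun t : UnitAddTorus (Fin s) => (measurableEquivPiIoc a t).1) volume
      (volume.restrict Q) :=
    (measurePreserving_subtype_coe hQm).comp (measurePreserving_equivPiIoc a)
  have hFm : MemLp F 2 volume := hf.comp_measurePreserving hmp
  have hFx : ∀ x ∈ Q, F (fun i => (x i : UnitAddCircle)) = f x := by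
    intro x hx
    have := (measurableEquivPiIoc a).apply_symm_apply ⟨x, hx⟩
    rw [coe_symm_measurableEquivPiIoc_apply] at this
    simp only [hF, this]
  have hco : ∀ k, mFourierCoeff (hFm.toLp F) k = fcoeff s f k := by
    intro k
    have : mFourierCoeff (hFm.toLp F) k = mFourierCoeff F k :=
      integral_congr_ae (ae_eq_rfl.mul hFm.coeFn_toLp)
    rw [this, mFourierCoeff_eq_integral F k a, fcoeff, ← Measure.restrict_congr_set (cube_Ioc_ae s)]
    refine setIntegral_congr_fun hQm fun x hx => ?_
    simp only [hFx x hx, mFourier_coe, smul_eq_mul]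
    rw [mul_comm]
    congr 2
    simp
  have h2 := hasSum_mFourier_series_L2 (hFm.toLp F)
  simp only [hco] at h2
  have hs : Summable (fun k => fcoeff s f k • (mFourier k : C(UnitAddTorus (Fin s), ℂ))) := by
    apply Summable.of_norm
    simpa only [norm_smul, mFourier_norm, mul_one] using hsum
  obtain ⟨g, hg⟩ := hs
  have h3 := (ContinuousMap.toLp (E := ℂ) 2 (volume : Measure (UnitAddTorus (Fin s))) ℂ).hasSum hg
  simp only [map_smul] at h3
  have h4 := h2.unique h3
  have h5 : F =ᵐ[volume] g := by
    refine hFm.coeFn_toLp.symm.trans ?_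
    rw [h4]
    exact ContinuousMap.coeFn_toLp volume g
  have hmp2 := (measurePreserving_equivPiIoc a).symm
  have h6 := hmp2.quasiMeasurePreserving.ae h5
  rw [ae_restrict_iff_subtype hQm]
  filter_upwards [h6] with x hx
  rw [← hFx x.1 x.2]
  have hx' : F (fun i => (x.1 i : UnitAddCircle)) = g (fun i => (x.1 i : UnitAddCircle)) := hx
  rw [hx']
  have h7 := (ContinuousMap.evalCLM ℂ (fun i => (x.1 i : UnitAddCircle)) : C(UnitAddTorus (Fin s), ℂ) →L[ℂ] ℂ).hasSum hg
  rw [← show _ = g (fun i => (x.1 i : UnitAddCircle)) from h7.tsum_eq]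
  refine tsum_congr fun k => ?_
  rw [← mFourier_coe]
  rfl

end torus

lemma norm_char (s : ℕ) (k : Fin s → ℤ) (x : Fin s → ℝ) :
    ‖Complex.exp (2 * (Real.pi : ℂ) * Complex.I * ∑ j, (k j : ℂ) * (x j : ℂ))‖ = 1 := by
  have : (2 * (Real.pi : ℂ) * Complex.I * ∑ j, (k j : ℂ) * (x j : ℂ)) =
    ((2 * Real.pi * ∑ j, (k j : ℝ) * x j : ℝ) : ℂ) * Complex.I := by
    push_cast; ring
  rw [this, Complex.norm_exp_ofReal_mul_I]

noncomputable def fser (s : ℕ) (f : (Fin s → ℝ) → ℂ) (x : Fin s → ℝ) : ℂ :=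
  ∑' k, fcoeff s f k * Complex.exp (2 * (Real.pi : ℂ) * Complex.I * ∑ j, (k j : ℂ) * (x j : ℂ))

lemma fser_cont (s : ℕ) (f : (Fin s → ℝ) → ℂ)
    (hsum : Summable fun k : Fin s → ℤ => ‖fcoeff s f k‖) : Continuous (fser s f) := by
  refine continuous_tsum (fun k => by fun_prop) hsum fun k x => ?_
  rw [norm_mul, norm_char, mul_one]

lemma eq_fser (s : ℕ) (f : (Fin s → ℝ) → ℂ) 
    (hc : ContinuousOn f (Set.pi Set.univ (fun _ : Fin s => Set.Ico (0 : ℝ) 1)))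
    (hsum : Summable fun k : Fin s → ℤ => ‖fcoeff s f k‖)
    (hae : ∀ᵐ x ∂(volume.restrict (Set.pi Set.univ (fun _ : Fin s => Set.Icc (0 : ℝ) 1))),
      f x = fser s f x)
    (x : Fin s → ℝ) (hx : x ∈ Set.pi Set.univ (fun _ : Fin s => Set.Ico (0 : ℝ) 1)) :
    f x = fser s f x := by
  by_contra hne
  have hc2 := (hc.sub (fser_cont s f hsum).continuousOn) x hx
  have h0 : f x - fser s f x ≠ 0 := sub_ne_zero.mpr hne
  have h1 := hc2.eventually_ne h0
  rw [eventually_nhdsWithin_iff, Metric.eventually_nhds_iff] at h1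
  obtain ⟨ε, hε, h1⟩ := h1
  rw [← Measure.restrict_congr_set (cube_Ico_ae s), ae_restrict_iff' (MeasurableSet.univ_pi (fun i => measurableSet_Ico))] at hae
  let b : Fin s → ℝ := fun j => min 1 (x j + ε / 2)
  have hb : ∀ j, x j < b j := fun j => lt_min (hx j trivial).2 (by linarith)
  have hsub : Set.pi Set.univ (fun j => Set.Ioo (x j) (b j)) ⊆ {y | ¬ (y ∈ Set.pi Set.univ (fun _ : Fin s => Set.Ico (0 : ℝ) 1) → f y = fser s f y)} := by
    intro y hy
    have hyQ : y ∈ Set.pi Set.univ (fun _ : Fin s => Set.Ico (0 : ℝ) 1) := fun j _ =>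
      ⟨(hx j trivial).1.trans (hy j trivial).1.le, (hy j trivial).2.trans_le (min_le_left _ _)⟩
    have hd : dist y x < ε := by
      rw [dist_pi_lt_iff hε]
      intro j
      rw [Real.dist_eq, abs_lt]
      have h1 := (hy j trivial).1
      have h2 := (hy j trivial).2.trans_le (min_le_right _ _)
      constructor <;> linarith
    have := h1 hd hyQ
    simp only [Set.mem_ofPred_eq, not_forall]
    exact ⟨hyQ, fun h => this (sub_eq_zero.mpr h)⟩
  have hz := measure_mono_null hsub hae
  have hop : IsOpen (Set.pi Set.univ (fun j => Set.Ioo (x j) (b j))) :=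
    isOpen_set_pi Set.finite_univ fun _ _ => isOpen_Ioo
  have hnon : (Set.pi Set.univ (fun j => Set.Ioo (x j) (b j))).Nonempty :=
    Set.univ_pi_nonempty_iff.mpr fun j => Set.nonempty_Ioo.mpr (hb j)
  exact (hop.measure_pos volume hnon).ne' hz

/-- If `f : ℝ^s → ℂ` is one-periodic in each variable with absolutely summable Fourier
coefficients and finite Hölder seminorm `|f|_{H_{α,p}}`, then for every `L ∈ ℕ`,
`|∑_{k ∈ ℤ^s, k ≠ 0} f̃(L·k)| ≤ (s^{α/p} / L^α) |f|_{H_{α,p}}`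
(where `s^{α/p}` is interpreted as `1` when `p = ∞`). -/
theorem stmt_6 (α : ℝ) (hα0 : 0 < α) (hα1 : α ≤ 1) (p : ℝ≥0∞) (hp : 1 ≤ p)
    (s : ℕ) (f : (Fin s → ℝ) → ℂ)
    (hper : ∀ (x : Fin s → ℝ) (j : Fin s), f (Function.update x j (x j + 1)) = f x)
    (hsum : Summable fun k : Fin s → ℤ => ‖fcoeff s f k‖)
    (hH : BddAbove (ratioSet s α p f))
    (L : ℕ) (hL : 1 ≤ L) :
    ‖∑' k : {k : Fin s → ℤ // k ≠ 0}, fcoeff s f (fun j => (L : ℤ) * (k : Fin s → ℤ) j)‖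
      ≤ (s : ℝ) ^ (α / p.toReal) / (L : ℝ) ^ α * holderSemi s α p f := by
  classical
  set Q := Set.pi Set.univ (fun _ : Fin s => Set.Icc (0 : ℝ) 1) with hQ
  set Q' := Set.pi Set.univ (fun _ : Fin s => Set.Ico (0 : ℝ) 1) with hQ'
  have hQQ : volume.restrict Q' = volume.restrict Q := Measure.restrict_congr_set (cube_Ico_ae s)
  have hQm : MeasurableSet Q' := MeasurableSet.univ_pi (fun i => measurableSet_Ico)
  have hvol : volume Q = 1 := by
    rw [hQ, volume_pi, Measure.pi_pi]; simp
  have hfin : IsFiniteMeasure (volume.restrict Q) := ⟨by simp [hvol]⟩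
  have hL0 : (0 : ℝ) < L := by exact_mod_cast hL
  have hcont := holder_cont α hα0 p hp s f hH
  have hmem : MemLp f 2 (volume.restrict Q) := by
    refine MemLp.of_bound (C := (s : ℝ) ^ (α / p.toReal) * 1 ^ α * holderSemi s α p f + ‖f 0‖) ?_ ?_
    · rw [← hQQ]; exact hcont.aestronglyMeasurable hQm
    · rw [← hQQ]
      filter_upwards [ae_restrict_mem hQm] with x hx
      have h0 : (0 : Fin s → ℝ) ∈ Q' := fun j _ => by simp
      have := holder_est α hα0 p hp s f hH 0 x h0 hx 1 zero_le_one (fun j => by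
        have h1 := hx j trivial
        rw [abs_le]; constructor <;> simp <;> linarith [h1.1, h1.2])
      have h2 := norm_add_le (f x - f 0) (f 0)
      rw [sub_add_cancel] at h2
      linarith
  have heq : ∀ x ∈ Q', f x = fser s f x :=
    eq_fser s f hcont hsum (fourier_ae s f hmem hsum)
  have hfc := fser_cont s f hsum
  set φ : (Fin s → ℝ) → (Fin s → ℝ) := fun x j => (⌊(L : ℝ) * x j⌋ : ℝ) / L with hφ
  have hφm : Measurable φ := by
    refine measurable_pi_lambda _ fun j => ?_
    have h1 : Measurable fun x : Fin s → ℝ => ⌊(L : ℝ) * x j⌋ :=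
      Int.measurable_floor.comp (measurable_const.mul (measurable_pi_apply j))
    exact ((measurable_from_top (f := fun n : ℤ => (n : ℝ))).comp h1).div_const _
  have hφd : ∀ x j, 0 ≤ x j - φ x j ∧ x j - φ x j ≤ 1 / L := by
    intro x j
    have h1 := Int.floor_le ((L : ℝ) * x j)
    have h2 := (Int.lt_floor_add_one ((L : ℝ) * x j)).le
    have h3 : φ x j * L = ⌊(L : ℝ) * x j⌋ := by simp only [hφ]; field_simp
    rw [← h3] at h1 h2
    constructor
    · nlinarith
    · rw [le_div_iff₀ hL0]; nlinarith
  have hφQ : ∀ x ∈ Q', φ x ∈ Q' := by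
    intro x hx j _
    have h1 := hx j trivial
    refine ⟨?_, by linarith [(hφd x j).1, h1.2]⟩
    have : (0 : ℤ) ≤ ⌊(L : ℝ) * x j⌋ := Int.floor_nonneg.mpr (mul_nonneg hL0.le h1.1)
    have : (0 : ℝ) ≤ ⌊(L : ℝ) * x j⌋ := by exact_mod_cast this
    simp only [hφ]; positivity
  -- the quadrature sum as an integral
  have hI : HasSum (fun k : Fin s → ℤ => fcoeff s f k * if ∀ j, (L : ℤ) ∣ k j then 1 else 0)
      (∫ x in Q, fser s f (φ x)) := by
    have hA := hasSum_integral_of_summable_integral_norm (μ := volume.restrict Q)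
      (F := fun (k : Fin s → ℤ) (x : Fin s → ℝ) => fcoeff s f k *
        Complex.exp (2 * (Real.pi : ℂ) * Complex.I * ∑ j, (k j : ℂ) * (φ x j : ℂ))) ?_ ?_
    · simp only [integral_const_mul] at hA
      have hB := fun k => multi_dim s L hL k
      simp only [← hQ] at hB
      simp only [hφ, hB] at hA
      exact hA
    · intro k
      refine Integrable.of_bound (C := ‖fcoeff s f k‖) ?_ ?_
      · have : Continuous fun y : Fin s → ℝ => fcoeff s f k *
          Complex.exp (2 * (Real.pi : ℂ) * Complex.I * ∑ j, (k j : ℂ) * (y j : ℂ)) := by fun_prop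
        exact (this.measurable.comp hφm).aestronglyMeasurable
      · refine Filter.Eventually.of_forall fun x => ?_
        rw [norm_mul, norm_char, mul_one]
    · simp only [norm_mul, norm_char, mul_one]
      simpa [Measure.real, hvol] using hsum
  set S := ∫ x in Q, fser s f (φ x) with hS
  have hinj : Function.Injective (fun (m : Fin s → ℤ) (j : Fin s) => (L : ℤ) * m j) := by
    intro m n h
    funext j
    have := congrFun h j
    exact mul_left_cancel₀ (by exact_mod_cast (by omega : L ≠ 0)) this
  have hJ : HasSum (fun m : Fin s → ℤ => fcoeff s f (fun j => (L : ℤ) * m j)) S := by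
    rw [← hinj.hasSum_iff] at hI
    · simpa [Function.comp_def] using hI
    · intro k hk
      rw [if_neg, mul_zero]
      intro hd
      choose m hm using hd
      exact hk ⟨m, (funext hm).symm⟩
  have hK : ∑' k : {k : Fin s → ℤ // k ≠ 0}, fcoeff s f (fun j => (L : ℤ) * (k : Fin s → ℤ) j)
      = S - fcoeff s f 0 := by
    have h1 := hJ.update 0 0
    have h2 : HasSum ((Function.update (fun m : Fin s → ℤ => fcoeff s f (fun j => (L : ℤ) * m j)) 0 0)
        ∘ (Subtype.val : {k : Fin s → ℤ // k ≠ 0} → _)) _ :=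
      (Subtype.val_injective.hasSum_iff (by
        intro k hk
        have : k = 0 := by simpa using hk
        simp [this])).mpr h1
    have h3 := h2.tsum_eq
    have e0 : (fun j : Fin s => (L : ℤ) * (0 : Fin s → ℤ) j) = 0 := by funext j; simp
    rw [e0] at h3
    rw [show S - fcoeff s f 0 = 0 - fcoeff s f 0 + S by ring, ← h3]
    refine tsum_congr fun k => ?_
    simp [Function.update_of_ne k.2]
  have hint1 : Integrable (fun x => fser s f (φ x)) (volume.restrict Q) := by
    refine Integrable.of_bound (C := ∑' k, ‖fcoeff s f k‖)
      (hfc.measurable.comp hφm).aestronglyMeasurable ?_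
    refine Filter.Eventually.of_forall fun x => ?_
    refine tsum_of_norm_bounded hsum.hasSum fun k => ?_
    rw [norm_mul, norm_char, mul_one]
  have hint2 : Integrable f (volume.restrict Q) := hmem.integrable (by norm_num)
  have hc0 : fcoeff s f 0 = ∫ x in Q, f x := by simp [fcoeff, hQ]
  rw [hK, hc0, hS, ← integral_sub hint1 hint2]
  have hb := norm_integral_le_of_norm_le_const (μ := volume.restrict Q)
    (f := fun x => fser s f (φ x) - f x)
    (C := (s : ℝ) ^ (α / p.toReal) * (1 / L : ℝ) ^ α * holderSemi s α p f) (by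
      rw [← hQQ]
      filter_upwards [ae_restrict_mem hQm] with x hx
      rw [← heq _ (hφQ x hx)]
      exact holder_est α hα0 p hp s f hH x (φ x) hx (hφQ x hx) _ (by positivity) (fun j => by
        rw [abs_sub_comm, abs_of_nonneg (hφd x j).1]; exact (hφd x j).2))
  refine hb.trans (le_of_eq ?_)
  rw [Real.div_rpow zero_le_one hL0.le, Real.one_rpow]
  have hv : (volume.restrict Q).real Set.univ = 1 := by simp [Measure.real, hvol]
  rw [hv]
  ring
end

section
/- Let F_q be a finite field with q = b^m elements, where b is prime and m ≥ 1, and let s ≥ 1 be an integer. For 1 ≤ j ≤ s let c_j be the j-th positive integer not divisible by b. Let a₁, …, a_s ∈ F_q, not all zero, and let ψ be a non-trivial additive character of F_q. Then |∑_{z ∈ F_q} ψ(a₁·z^{c₁} + a₂·z^{c₂} + ⋯ + a_s·z^{c_s})| ≤ (s·b/(b−1) − 1)·√q. -/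
open scoped BigOperators

namespace WeilB

open Polynomial

lemma natDegree_T {K : Type*} [Field K] (p : ℕ) (hp : 2 ≤ p) (f : K[X]) (hd : 1 ≤ f.natDegree) (μ : ℕ) :
    (∑ i ∈ Finset.range (μ+1), f ^ (p ^ i)).natDegree = p ^ μ * f.natDegree := by
  induction μ with
  | zero => simp
  | succ n ih =>
    rw [Finset.sum_range_succ, Polynomial.natDegree_add_eq_right_of_natDegree_lt]
    · rw [natDegree_pow]
    · rw [ih, natDegree_pow]
      apply Nat.mul_lt_mul_of_pos_right _ hd
      exact Nat.pow_lt_pow_right (by omega) (by omega)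

/-- Stepanov bound -/
lemma stepanov (p : ℕ) [hp : Fact p.Prime] (K : Type*) [Field K] [Fintype K] [DecidableEq K]
    [CharP K p] (μ : ℕ)
    (hK : Fintype.card K = (p ^ (μ+1)) ^ 2) (f : K[X]) (hd : ¬ p ∣ f.natDegree) (t : K) :
    p * (Finset.univ.filter (fun x : K => ∑ i ∈ Finset.range (2*(μ+1)), (f.eval x) ^ (p ^ i) = t)).card
      ≤ (p ^ (μ+1)) ^ 2 + 3 * f.natDegree * p * p ^ (μ+1) := by
  classical
  have hp2 : 2 ≤ p := hp.out.two_le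
  set d := f.natDegree with hdd
  have hd1 : 1 ≤ d := by
    rcases Nat.eq_zero_or_pos d with h | h
    · rw [h] at hd; simp at hd
    · exact h
  set P0 := p ^ μ with hP0
  have hP01 : 1 ≤ P0 := Nat.one_le_pow _ _ (by omega)
  have hPP : p ^ (μ+1) = p * P0 := by rw [pow_succ, mul_comm]
  set P := p ^ (μ+1) with hP
  set T : K[X] := ∑ i ∈ Finset.range (μ+1), f ^ (p ^ i) with hT
  have hTdeg : T.natDegree = P0 * d := natDegree_T p hp2 f hd1 μ
  have hT0 : T ≠ 0 := by
    intro h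
    rw [h, natDegree_zero] at hTdeg
    have := Nat.mul_pos hP01 hd1
    omega
  let I := Fin (P0 + 2*d) × Fin p × Fin P0
  set D := P * (P0-1) + (P0 + 2*d - 1) + (p-1) * (P0 * d) with hD
  let g : (I → K) → K[X] := fun a => ∑ x : I, C (a x) * X ^ (x.2.2.1 + x.1.1 * P) * T ^ x.2.1.1
  let R : (I → K) → K[X] := fun a => ∑ x : I, C (a x ^ P) * X ^ (x.2.2.1 * P + x.1.1) * (C t - T) ^ x.2.1.1
  have hRdeg : ∀ a, (R a).natDegree ≤ D := by
    intro a
    apply natDegree_sum_le_of_forall_le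
    rintro ⟨i, j, k⟩ -
    refine (natDegree_mul_le).trans ?_
    have h1 : (C (a (i,j,k) ^ P) * X ^ (k.1 * P + i.1)).natDegree ≤ k.1 * P + i.1 := natDegree_C_mul_X_pow_le _ _
    have h2 : ((C t - T) ^ j.1).natDegree ≤ j.1 * (P0 * d) := by
      refine natDegree_pow_le.trans ?_
      apply Nat.mul_le_mul_left
      refine (natDegree_sub_le _ _).trans ?_
      simp [hTdeg]
    refine (add_le_add h1 h2).trans ?_
    have := k.2; have := i.2; have := j.2
    have h3 : k.1 * P ≤ P * (P0 - 1) := by rw [mul_comm]; apply Nat.mul_le_mul_left; omega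
    have h4 : j.1 * (P0 * d) ≤ (p-1) * (P0*d) := by apply Nat.mul_le_mul_right; omega
    omega
  -- pigeonhole
  have hex : ∃ a : I → K, a ≠ 0 ∧ R a = 0 := by
    let φ : (I → K) → (Fin (D+1) → K) := fun a n => (R a).coeff n
    have hcard : Fintype.card (Fin (D+1) → K) < Fintype.card (I → K) := by
      rw [Fintype.card_fun, Fintype.card_fun]
      apply Nat.pow_lt_pow_right
      · exact Fintype.one_lt_card
      · simp only [I, Fintype.card_fin, Fintype.card_prod]
        obtain ⟨q0, hq0⟩ : ∃ q0, P0 = q0 + 1 := ⟨P0 - 1, by omega⟩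
        obtain ⟨r, hr⟩ : ∃ r, p = r + 2 := ⟨p - 2, by omega⟩
        obtain ⟨e, he⟩ : ∃ e, d = e + 1 := ⟨d - 1, by omega⟩
        rw [hD, hPP, hq0, hr, he]
        have e1 : q0 + 1 - 1 = q0 := by omega
        have e2 : r + 2 - 1 = r + 1 := by omega
        have e3 : q0 + 1 + 2 * (e+1) - 1 = q0 + 2 * e + 2 := by omega
        rw [e1, e2, e3]
        ring_nf
        nlinarith [Nat.zero_le (q0*r*e), Nat.zero_le (q0*r), Nat.zero_le (q0*e), Nat.zero_le (r*e)]
    obtain ⟨a, a', hne, haa⟩ := Fintype.exists_ne_map_eq_of_card_lt φ hcard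
    refine ⟨a - a', sub_ne_zero.mpr hne, ?_⟩
    have hsub : R (a - a') = R a - R a' := by
      simp only [R]
      rw [← Finset.sum_sub_distrib]
      apply Finset.sum_congr rfl
      intro x _
      rw [Pi.sub_apply, hP, sub_pow_char_pow, C_sub]
      ring
    rw [hsub, sub_eq_zero]
    ext n
    by_cases hn : n < D + 1
    · exact congrFun haa ⟨n, hn⟩
    · rw [coeff_eq_zero_of_natDegree_lt, coeff_eq_zero_of_natDegree_lt]
      · have := hRdeg a'; omega
      · have := hRdeg a; omega
  obtain ⟨a, ha0, haR⟩ := hex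
  have hterm : ∀ x : I, a x ≠ 0 → (C (a x) * X ^ (x.2.2.1 + x.1.1 * P) * T ^ x.2.1.1) ≠ 0 := by
    intro x hx
    refine mul_ne_zero (mul_ne_zero (by simpa using hx) (pow_ne_zero _ X_ne_zero)) (pow_ne_zero _ hT0)
  have htd : ∀ x : I, a x ≠ 0 → (C (a x) * X ^ (x.2.2.1 + x.1.1 * P) * T ^ x.2.1.1).natDegree
      = x.2.2.1 + x.1.1 * P + x.2.1.1 * (P0 * d) := by
    intro x hx
    rw [natDegree_mul (mul_ne_zero (by simpa using hx) (pow_ne_zero _ X_ne_zero)) (pow_ne_zero _ hT0),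
      natDegree_C_mul_X_pow _ _ hx, natDegree_pow, hTdeg]
  have hinj : ∀ x y : I, x.2.2.1 + x.1.1 * P + x.2.1.1 * (P0 * d) = y.2.2.1 + y.1.1 * P + y.2.1.1 * (P0 * d) →
      x = y := by
    rintro ⟨i, j, k⟩ ⟨i', j', k'⟩ h
    simp only at h
    have h1 : k.1 + P0 * (p * i.1 + d * j.1) = k'.1 + P0 * (p * i'.1 + d * j'.1) := by
      rw [hPP] at h; linarith [h]
    have hk : k.1 = k'.1 := by
      have := congrArg (· % P0) h1
      simpa [Nat.add_mul_mod_self_left, Nat.mod_eq_of_lt k.2, Nat.mod_eq_of_lt k'.2] using this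
    have h2 : p * i.1 + d * j.1 = p * i'.1 + d * j'.1 := by
      rw [hk] at h1
      exact Nat.eq_of_mul_eq_mul_left hP01 (Nat.add_left_cancel h1)
    have hj : j.1 = j'.1 := by
      have h3 : d * j.1 ≡ d * j'.1 [MOD p] := by
        have := congrArg (· % p) h2
        simpa [Nat.ModEq] using this
      have hcop : Nat.gcd p d = 1 := (Nat.Prime.coprime_iff_not_dvd hp.out).mpr hd
      have h4 := Nat.ModEq.cancel_left_of_coprime hcop h3
      have := h4
      rw [Nat.ModEq, Nat.mod_eq_of_lt j.2, Nat.mod_eq_of_lt j'.2] at this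
      exact this
    have hi : i.1 = i'.1 := by
      rw [hj] at h2
      exact Nat.eq_of_mul_eq_mul_left (by omega) (Nat.add_right_cancel h2)
    exact Prod.ext (Fin.ext hi) (Prod.ext (Fin.ext hj) (Fin.ext hk))
  have hg0 : g a ≠ 0 := by
    obtain ⟨x0, hx0⟩ := Function.ne_iff.mp ha0
    intro h0
    have hdis := Polynomial.degree_sum_eq_of_disjoint
      (fun x : I => C (a x) * X ^ (x.2.2.1 + x.1.1 * P) * T ^ x.2.1.1) Finset.univ (by
        intro x hx y hy hxy hdeg
        simp only [Finset.mem_univ, true_and, Set.mem_ofPred_eq] at hx hy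
        have hax : a x ≠ 0 := by intro h; simp [h] at hx
        have hay : a y ≠ 0 := by intro h; simp [h] at hy
        apply hxy
        apply hinj
        rw [← htd x hax, ← htd y hay]
        exact natDegree_eq_of_degree_eq hdeg)
    change degree (g a) = _ at hdis
    rw [h0, degree_zero] at hdis
    have hle := Finset.le_sup (f := fun x : I => (C (a x) * X ^ (x.2.2.1 + x.1.1 * P) * T ^ x.2.1.1).degree) (Finset.mem_univ x0)
    rw [← hdis] at hle
    exact hterm x0 hx0 (degree_eq_bot.mp (le_bot_iff.mp hle))
  have hgdeg : (g a).natDegree ≤ (P0 - 1) + (P0 + 2*d-1) * P + (p-1)*(P0*d) := by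
    apply natDegree_sum_le_of_forall_le
    intro x _
    by_cases hx : a x = 0
    · simp [hx]
    · rw [htd x hx]
      have := x.1.2; have := x.2.1.2; have := x.2.2.2
      have h3 : x.1.1 * P ≤ (P0 + 2*d-1) * P := by apply Nat.mul_le_mul_right; omega
      have h4 : x.2.1.1 * (P0 * d) ≤ (p-1) * (P0*d) := by apply Nat.mul_le_mul_right; omega
      omega
  have hsub : (Finset.univ.filter (fun x : K => ∑ i ∈ Finset.range (2*(μ+1)), (f.eval x) ^ (p ^ i) = t)) ⊆
      (g a).roots.toFinset := by
    intro x hx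
    simp only [Finset.mem_filter, Finset.mem_univ, true_and] at hx
    rw [Multiset.mem_toFinset, mem_roots hg0, IsRoot.def]
    have hTx : T.eval x ^ P = t - T.eval x := by
      rw [eq_sub_iff_add_eq, ← hx, two_mul, Finset.sum_range_add, add_comm]
      congr 1
      · simp [hT, eval_finsetSum]
      · rw [hT, eval_finsetSum, hP, sum_pow_char_pow]
        apply Finset.sum_congr rfl
        intro i _
        rw [eval_pow, ← pow_mul, pow_add]
        congr 1
        ring
    have hxP : (x ^ P) ^ P = x := by
      rw [← pow_mul, ← sq, ← hK, FiniteField.pow_card]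
    have hev : (g a).eval x ^ P = (R a).eval x := by
      simp only [g, R, eval_finsetSum, hP, sum_pow_char_pow]
      apply Finset.sum_congr rfl
      intro y _
      rw [← hP]
      simp only [eval_mul, eval_pow, eval_C, eval_X, eval_sub]
      rw [mul_pow, mul_pow, ← hTx]
      congr 1
      · congr 1
        rw [pow_add, mul_pow, pow_add, ← pow_mul]
        congr 1
        rw [mul_comm, pow_mul, pow_right_comm, hxP]
      · ring
    rw [haR, eval_zero] at hev
    exact eq_zero_of_pow_eq_zero hev
  have hN := (Finset.card_le_card hsub).trans ((Multiset.toFinset_card_le _).trans ((card_roots' _).trans hgdeg))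
  refine (Nat.mul_le_mul_left p hN).trans ?_
  obtain ⟨q0, hq0⟩ : ∃ q0, P0 = q0 + 1 := ⟨P0 - 1, by omega⟩
  obtain ⟨r, hr⟩ : ∃ r, p = r + 2 := ⟨p - 2, by omega⟩
  obtain ⟨e, he⟩ : ∃ e, d = e + 1 := ⟨d - 1, by omega⟩
  rw [hPP, hq0, hr, he]
  have e1 : q0 + 1 - 1 = q0 := by omega
  have e2 : r + 2 - 1 = r + 1 := by omega
  have e3 : q0 + 1 + 2 * (e+1) - 1 = q0 + 2 * e + 2 := by omega
  rw [e1, e2, e3]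
  zify
  nlinarith [Nat.zero_le (q0*r*e), Nat.zero_le (q0*r), Nat.zero_le (q0*e), Nat.zero_le (r*e)]

end WeilB

namespace WeilB

open Polynomial

lemma charsum_bound (p : ℕ) [hp : Fact p.Prime] (K : Type*) [Field K] [Fintype K]
    [Algebra (ZMod p) K] (μ : ℕ)
    (hK : Fintype.card K = (p ^ (μ+1)) ^ 2) (f : K[X]) (hd : ¬ p ∣ f.natDegree)
    (ψ : AddChar (ZMod p) ℂ) (hψ : ψ ≠ 1) :
    ‖∑ x : K, ψ (Algebra.trace (ZMod p) K (f.eval x))‖ ≤ 3 * f.natDegree * p * (p:ℝ) ^ (μ+1) := by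
  classical
  have : CharP K p := charP_of_injective_algebraMap (algebraMap (ZMod p) K).injective p
  have hp0 : (0:ℝ) < p := by exact_mod_cast hp.out.pos
  set P : ℝ := (p:ℝ) ^ (μ+1) with hP
  set d : ℝ := (f.natDegree : ℝ)
  have hfr : Module.finrank (ZMod p) K = 2 * (μ+1) := by
    have h := Module.card_eq_pow_finrank (K := ZMod p) (V := K)
    rw [hK, ZMod.card, ← pow_mul] at h
    have := Nat.pow_right_injective hp.out.two_le h
    omega
  let n : ZMod p → ℕ := fun t => (Finset.univ.filter (fun x : K => Algebra.trace (ZMod p) K (f.eval x) = t)).card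
  have hn : ∀ t, (n t : ℝ) ≤ (P^2 + 3 * d * p * P) / p := by
    intro t
    have h := stepanov p K μ hK f hd (algebraMap _ _ t)
    have he : (Finset.univ.filter (fun x : K => ∑ i ∈ Finset.range (2*(μ+1)), (f.eval x) ^ (p ^ i) = algebraMap (ZMod p) K t)) = (Finset.univ.filter (fun x : K => Algebra.trace (ZMod p) K (f.eval x) = t)) := by
      ext x
      simp only [Finset.mem_filter, Finset.mem_univ, true_and]
      have := FiniteField.algebraMap_trace_eq_sum_pow (ZMod p) K (f.eval x)
      rw [Nat.card_zmod, hfr] at this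
      rw [← this]
      exact (algebraMap (ZMod p) K).injective.eq_iff
    rw [he] at h
    rw [le_div_iff₀ hp0]
    have h' : ((p * n t : ℕ) : ℝ) ≤ (((p ^ (μ+1)) ^ 2 + 3 * f.natDegree * p * p ^ (μ+1) : ℕ) : ℝ) := by exact_mod_cast h
    push_cast at h'
    rw [mul_comm]; exact h'
  have hsumn : ∑ t : ZMod p, (n t : ℝ) = P^2 := by
    have : ∑ t : ZMod p, n t = Fintype.card K := by
      rw [← Finset.card_univ, Finset.card_eq_sum_card_fiberwise (f := fun x : K => Algebra.trace (ZMod p) K (f.eval x)) (t := Finset.univ)]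
      intro x _; simp
    have h2 : ((∑ t : ZMod p, n t : ℕ) : ℝ) = ((p ^ (μ+1)) ^ 2 : ℕ) := by rw [this, hK]
    push_cast at h2
    exact h2
  set U : ℝ := (P^2 + 3 * d * p * P) / p with hU
  have hS : ∑ x : K, ψ (Algebra.trace (ZMod p) K (f.eval x)) = ∑ t : ZMod p, ((n t : ℂ) - U) * ψ t := by
    simp only [sub_mul]
    rw [Finset.sum_sub_distrib, ← Finset.mul_sum, AddChar.sum_eq_zero_of_ne_one hψ, mul_zero, sub_zero]
    rw [← Finset.sum_fiberwise_of_maps_to (s := Finset.univ) (t := Finset.univ) (g := fun x : K => Algebra.trace (ZMod p) K (f.eval x)) (fun _ _ => Finset.mem_univ _)]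
    apply Finset.sum_congr rfl
    intro t _
    rw [Finset.sum_congr rfl (g := fun _ => ψ t)]
    · rw [Finset.sum_const, nsmul_eq_mul]
    · intro x hx
      rw [(Finset.mem_filter.mp hx).2]
  rw [hS]
  refine (norm_sum_le _ _).trans ?_
  have : ∀ t ∈ Finset.univ, ‖((n t : ℂ) - U) * ψ t‖ = U - n t := by
    intro t _
    rw [norm_mul, AddChar.norm_apply, mul_one]
    have : ((n t : ℂ) - U) = (((n t : ℝ) - U : ℝ) : ℂ) := by push_cast; rfl
    rw [this, Complex.norm_real, Real.norm_eq_abs, abs_of_nonpos (by linarith [hn t])]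
    ring
  rw [Finset.sum_congr rfl this, Finset.sum_sub_distrib, hsumn, Finset.sum_const, Finset.card_univ, ZMod.card, nsmul_eq_mul, hU]
  rw [mul_div_cancel₀ _ hp0.ne']
  linarith

end WeilB

namespace WeilB

open Polynomial

noncomputable section

/-- reversed polynomial as a power series -/
def rv {R : Type*} [Field R] (g : R[X]) : PowerSeries R := (g.reverse : PowerSeries R)

/-- generating series of the power sums of the roots -/
def nP {R : Type*} [Field R] (g : R[X]) : PowerSeries R :=
  - PowerSeries.X * PowerSeries.derivative R (rv g) * (rv g)⁻¹

lemma rv_cc {R : Type*} [Field R] (g : R[X]) : PowerSeries.constantCoeff (rv g) = g.leadingCoeff := by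
  rw [rv, ← PowerSeries.coeff_zero_eq_constantCoeff_apply, Polynomial.coeff_coe, coeff_zero_reverse]

lemma rv_mul {R : Type*} [Field R] (g h : R[X]) : rv (g * h) = rv g * rv h := by
  rw [rv, reverse_mul_of_domain, Polynomial.coe_mul]; rfl

lemma nP_spec {R : Type*} [Field R] (g : R[X]) (hg : g ≠ 0) :
    nP g * rv g = - PowerSeries.X * PowerSeries.derivative R (rv g) := by
  rw [nP, mul_assoc, PowerSeries.inv_mul_cancel, mul_one]
  rw [rv_cc]; exact leadingCoeff_ne_zero.mpr hg

lemma rv_ne {R : Type*} [Field R] (g : R[X]) (hg : g ≠ 0) : rv g ≠ 0 := by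
  intro h
  have := rv_cc g
  rw [h, map_zero] at this
  exact leadingCoeff_ne_zero.mpr hg this.symm

lemma nP_unique {R : Type*} [Field R] (g : R[X]) (hg : g ≠ 0) (s : PowerSeries R)
    (h : s * rv g = - PowerSeries.X * PowerSeries.derivative R (rv g)) : nP g = s := by
  apply mul_right_cancel₀ (rv_ne g hg)
  rw [h, nP_spec g hg]

lemma nP_mul {R : Type*} [Field R] (g h : R[X]) (hg : g ≠ 0) (hh : h ≠ 0) :
    nP (g * h) = nP g + nP h := by
  apply nP_unique _ (mul_ne_zero hg hh)
  rw [rv_mul, Derivation.leibniz]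
  have h1 := nP_spec g hg
  have h2 := nP_spec h hh
  simp only [smul_eq_mul]
  linear_combination (rv h) * h1 + (rv g) * h2

lemma nP_one {R : Type*} [Field R] : nP (1 : R[X]) = 0 := by
  have := nP_mul (1 : R[X]) 1 one_ne_zero one_ne_zero
  rw [mul_one] at this
  exact left_eq_add.mp this

lemma nP_pow {R : Type*} [Field R] (g : R[X]) (hg : g ≠ 0) (k : ℕ) : nP (g ^ k) = k • nP g := by
  induction k with
  | zero => simp [nP_one]
  | succ k ih => rw [pow_succ, nP_mul _ _ (pow_ne_zero _ hg) hg, ih, succ_nsmul]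

lemma coeff_zero_nP {R : Type*} [Field R] (g : R[X]) : PowerSeries.coeff 0 (nP g) = 0 := by
  rw [nP, PowerSeries.coeff_zero_eq_constantCoeff_apply]
  simp

lemma rv_map {R S : Type*} [Field R] [Field S] (φ : R →+* S) (g : R[X]) :
    PowerSeries.map φ (rv g) = rv (g.map φ) := by
  ext n
  simp [rv, coeff_reverse]

lemma nP_map {R S : Type*} [Field R] [Field S] (φ : R →+* S) (g : R[X]) (hg : g ≠ 0) :
    PowerSeries.map φ (nP g) = nP (g.map φ) := by
  symm
  apply nP_unique _ (by rwa [Polynomial.map_ne_zero_iff φ.injective])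
  rw [← rv_map, ← map_mul, nP_spec g hg, map_mul, map_neg, PowerSeries.map_X]
  congr 1
  ext n
  simp [PowerSeries.coeff_derivative]

lemma nP_X_sub_C {R : Type*} [Field R] (a : R) :
    nP (X - C a) = PowerSeries.mk (fun n => if n = 0 then 0 else a ^ n) := by
  apply nP_unique _ (X_sub_C_ne_zero a)
  have hr : rv (X - C a) = 1 - PowerSeries.C a * PowerSeries.X := by
    have : (X - C a).reverse = 1 - C a * X := by
      rw [reverse, natDegree_X_sub_C, reflect_sub, reflect_C]
      simp
    rw [rv, this]
    simp
  rw [hr]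
  ext n
  simp only [map_sub, PowerSeries.derivative_one, Derivation.leibniz, PowerSeries.derivative_X, PowerSeries.derivative_C, mul_sub, mul_one]
  rcases n with _ | n
  · simp
  · rw [mul_comm (PowerSeries.C a), ← mul_assoc]
    simp only [map_sub, smul_eq_mul, mul_one, mul_zero, zero_sub, PowerSeries.coeff_mk, neg_mul, mul_neg, map_neg, neg_neg,
      add_zero]
    rw [PowerSeries.coeff_mul_C, PowerSeries.coeff_succ_mul_X, PowerSeries.coeff_mk, PowerSeries.coeff_succ_X_mul]
    rw [PowerSeries.coeff_C]
    rcases n with _ | n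
    · simp
    · simp [pow_succ]

lemma coeff_nP_prod {R : Type*} [Field R] (s : Multiset R) (j : ℕ) (hj : j ≠ 0) :
    PowerSeries.coeff j (nP (s.map (fun a => X - C a)).prod) = (s.map (fun a => a ^ j)).sum := by
  induction s using Multiset.induction_on with
  | empty => simp [nP_one]
  | cons a s ih =>
    rw [Multiset.map_cons, Multiset.prod_cons, nP_mul _ _ (X_sub_C_ne_zero a), map_add, ih, nP_X_sub_C]
    · simp [hj]
    · apply (monic_multiset_prod_of_monic _ _ (fun a _ => monic_X_sub_C a)).ne_zero

lemma nP_shift {R : Type*} [Field R] (g : R[X]) (hg : g.Monic) (d : ℕ) (hd1 : 1 ≤ d)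
    (hd : d ≤ g.natDegree) (c : R) :
    (g + C c * X ^ (g.natDegree - d)).Monic ∧ (g + C c * X ^ (g.natDegree - d)).natDegree = g.natDegree ∧
    ∀ j ≤ d, PowerSeries.coeff j (nP (g + C c * X ^ (g.natDegree - d))) =
      PowerSeries.coeff j (nP g) - if j = d then d * c else 0 := by
  set n := g.natDegree with hn
  have hlt : (C c * X ^ (n - d)).degree < g.degree := by
    rw [degree_eq_natDegree hg.ne_zero, ← hn]
    refine (degree_C_mul_X_pow_le _ _).trans_lt ?_
    exact_mod_cast (by omega : n - d < n)
  have hm : (g + C c * X ^ (n - d)).Monic := hg.add_of_left hlt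
  have hnd : (g + C c * X ^ (n - d)).natDegree = n := natDegree_add_eq_left_of_degree_lt hlt
  refine ⟨hm, hnd, ?_⟩
  have hr : rv (g + C c * X ^ (n - d)) = rv g + PowerSeries.C c * PowerSeries.X ^ d := by
    have h1 : (g + C c * X ^ (n-d)).reverse = g.reverse + C c * X ^ d := by
      rw [reverse, hnd, reflect_add, reflect_C_mul_X_pow, revAt_le (by omega), reverse]
      congr 3
      omega
    rw [rv, h1, rv]
    simp
  set G := g + C c * X ^ (n - d)
  have s1 := nP_spec g hg.ne_zero
  have s2 := nP_spec G hm.ne_zero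
  have hX1 : (PowerSeries.X : PowerSeries R) ∣ nP g := by
    rw [PowerSeries.X_dvd_iff, ← PowerSeries.coeff_zero_eq_constantCoeff_apply, coeff_zero_nP]
  have hX2 : (PowerSeries.X : PowerSeries R) ∣ rv G - 1 := by
    rw [PowerSeries.X_dvd_iff, map_sub, rv_cc, hm.leadingCoeff, map_one, sub_self]
  obtain ⟨u, hu⟩ := hX1
  obtain ⟨v, hv⟩ := hX2
  have hder : PowerSeries.derivative R (rv G) = PowerSeries.derivative R (rv g) + PowerSeries.C ((d:R) * c) * PowerSeries.X ^ (d-1) := by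
    rw [hr, map_add, Derivation.leibniz, PowerSeries.derivative_C, PowerSeries.derivative_pow, PowerSeries.derivative_X]
    simp only [smul_eq_mul, mul_one, mul_zero, add_zero, map_mul, map_natCast]
    ring
  have hXd : PowerSeries.X * PowerSeries.X ^ (d-1) = (PowerSeries.X : PowerSeries R) ^ d := by
    rw [← pow_succ']; congr 1; omega
  have key : (nP G - nP g + PowerSeries.C ((d:R) * c) * PowerSeries.X ^ d) * rv G
      = PowerSeries.X ^ (d+1) * (PowerSeries.C ((d:R) * c) * v - PowerSeries.C c * u) := by
    rw [hder] at s2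
    have e1 : nP g * rv G = - PowerSeries.X * PowerSeries.derivative R (rv g) + PowerSeries.X * u * (PowerSeries.C c * PowerSeries.X ^ d) := by
      rw [hr, mul_add, s1, ← hu]
    have e2 : rv G = 1 + PowerSeries.X * v := by rw [← hv]; ring
    have e3 : PowerSeries.C ((d:R) * c) * PowerSeries.X ^ d * rv G = PowerSeries.C ((d:R) * c) * PowerSeries.X ^ d * (1 + PowerSeries.X * v) := by
      rw [← e2]
    rw [add_mul, sub_mul, s2, e1, e3]
    linear_combination (- PowerSeries.C ((d:R) * c)) * hXd
  have hdvd : PowerSeries.X ^ (d+1) ∣ (nP G - nP g + PowerSeries.C ((d:R) * c) * PowerSeries.X ^ d) := by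
    have hunit : IsUnit (rv G) := by
      rw [PowerSeries.isUnit_iff_constantCoeff, rv_cc, hm.leadingCoeff]; exact isUnit_one
    rw [← hunit.dvd_mul_right]
    exact ⟨_, key⟩
  rw [PowerSeries.X_pow_dvd_iff] at hdvd
  intro j hj
  have := hdvd j (by omega)
  rw [map_add, map_sub, PowerSeries.coeff_C_mul, PowerSeries.coeff_X_pow] at this
  split_ifs with h
  · rw [if_pos h] at this; linear_combination this
  · rw [if_neg h] at this; linear_combination this

end

end WeilB

namespace WeilB

open Polynomial

noncomputable section

lemma mon_finite (F : Type*) [Field F] [Finite F] (n : ℕ) :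
    {g : F[X] | g.Monic ∧ g.natDegree = n}.Finite := by
  apply Set.Finite.of_finite_image (f := fun g : F[X] => fun i : Fin (n+1) => g.coeff i)
  · exact Set.toFinite _
  · rintro g ⟨hg, hgn⟩ h ⟨hh, hhn⟩ hgh
    ext i
    by_cases hi : i < n + 1
    · exact congrFun hgh ⟨i, hi⟩
    · rw [coeff_eq_zero_of_natDegree_lt (by omega), coeff_eq_zero_of_natDegree_lt (by omega)]

def Mon (F : Type*) [Field F] [Finite F] (n : ℕ) : Finset F[X] := (mon_finite F n).toFinset

lemma mem_Mon {F : Type*} [Field F] [Finite F] {n : ℕ} {g : F[X]} :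
    g ∈ Mon F n ↔ g.Monic ∧ g.natDegree = n := by
  simp [Mon]

def lam {F : Type*} [Field F] (f g : F[X]) : F :=
  ∑ j ∈ Finset.range (f.natDegree + 1), f.coeff j * PowerSeries.coeff j (nP g)

lemma lam_mul {F : Type*} [Field F] (f g h : F[X]) (hg : g ≠ 0) (hh : h ≠ 0) :
    lam f (g * h) = lam f g + lam f h := by
  simp only [lam, nP_mul g h hg hh, map_add, mul_add, Finset.sum_add_distrib]

def AA {F : Type*} [Field F] [Finite F] (f : F[X]) (ψ : AddChar F ℂ) (n : ℕ) : ℂ :=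
  ∑ g ∈ Mon F n, ψ (lam f g)

lemma AA_zero {F : Type*} [Field F] [Finite F] (f : F[X]) (ψ : AddChar F ℂ) : AA f ψ 0 = 1 := by
  have : Mon F 0 = {1} := by
    ext g
    rw [mem_Mon, Finset.mem_singleton]
    constructor
    · rintro ⟨h1, h2⟩
      exact h1.natDegree_eq_zero.mp h2
    · rintro rfl
      exact ⟨monic_one, natDegree_one⟩
  rw [AA, this]
  simp [lam, nP_one]

lemma AA_eq_zero {F : Type*} [Field F] [Finite F] (f : F[X]) (hf : (f.natDegree : F) ≠ 0)
    (ψ : AddChar F ℂ) (hψ : ψ ≠ 1) (n : ℕ) (hn : f.natDegree ≤ n) : AA f ψ n = 0 := by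
  set d := f.natDegree with hd
  have hd1 : 1 ≤ d := by
    rcases Nat.eq_zero_or_pos d with h | h
    · simp [h] at hf
    · exact h
  have hlc : f.coeff d ≠ 0 := by
    have : f ≠ 0 := by rintro rfl; simp at hd; omega
    exact leadingCoeff_ne_zero.mpr this
  obtain ⟨y, hy⟩ := (AddChar.ne_one_iff).mp hψ
  -- choose c
  set c : F := - y / (f.coeff d * d) with hc
  have hc' : f.coeff d * (d * c) = - y := by
    rw [hc]; field_simp
  have hsh : ∀ g ∈ Mon F n, g + C c * X ^ (n - d) ∈ Mon F n ∧ lam f (g + C c * X ^ (n - d)) = lam f g + y := by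
    intro g hg
    rw [mem_Mon] at hg
    obtain ⟨h1, h2, h3⟩ := nP_shift g hg.1 d hd1 (by omega) c
    rw [hg.2] at h1 h2 h3
    refine ⟨mem_Mon.mpr ⟨h1, h2⟩, ?_⟩
    rw [lam, lam, ← hd, Finset.sum_congr rfl (g := fun j => f.coeff j * PowerSeries.coeff j (nP g) - if j = d then f.coeff d * (d * c) else 0)]
    · rw [Finset.sum_sub_distrib, Finset.sum_ite_eq' ]
      simp [hc']
    · intro j hj
      rw [h3 j (by simp at hj; omega)]
      split_ifs with h
      · rw [h]; ring
      · ring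
  have key : AA f ψ n = ψ y * AA f ψ n := by
    conv_lhs => rw [AA]
    rw [AA, Finset.mul_sum]
    symm
    apply Finset.sum_bij (fun g _ => g + C c * X ^ (n - d))
    · intro g hg; exact (hsh g hg).1
    · intro g _ h _ e; exact add_right_cancel e
    · have hinj : Set.InjOn (fun g : F[X] => g + C c * X ^ (n - d)) (Mon F n) := fun g _ h _ e => add_right_cancel e
      have := Finset.surjOn_of_injOn_of_card_le _ (fun g hg => (hsh g hg).1) hinj le_rfl
      intro g hg
      obtain ⟨h, hh, e⟩ := this hg
      exact ⟨h, hh, e⟩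
    · intro g hg
      rw [(hsh g hg).2, AddChar.map_add_eq_mul, mul_comm]
  have : (1 - ψ y) * AA f ψ n = 0 := by linear_combination key
  rcases mul_eq_zero.mp this with h | h
  · exact absurd (sub_eq_zero.mp h).symm hy
  · exact h

open IntermediateField in
lemma trace_pow_eq {F K : Type*} [Field F] [Finite F] [Field K] [Finite K] [Algebra F K] (α : K) (j : ℕ) (hj : j ≠ 0) :
    Algebra.trace F K (α ^ j) =
      PowerSeries.coeff j (nP (minpoly F α ^ (Module.finrank F K / (minpoly F α).natDegree))) := by
  classical
  have hint : IsIntegral F α := Algebra.IsIntegral.isIntegral α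
  have hm0 : minpoly F α ≠ 0 := minpoly.ne_zero hint
  have : FiniteDimensional F K := Module.Finite.of_finite
  let E := AlgebraicClosure F
  have hdeg : Module.finrank F F⟮α⟯ = (minpoly F α).natDegree := adjoin.finrank hint
  have htow : Module.finrank F F⟮α⟯ * Module.finrank F⟮α⟯ K = Module.finrank F K := Module.finrank_mul_finrank _ _ _
  have hk : Module.finrank F K / (minpoly F α).natDegree = Module.finrank F⟮α⟯ K := by
    rw [← htow, hdeg, Nat.mul_div_cancel_left _ (minpoly.natDegree_pos hint)]
  rw [hk, nP_pow _ hm0, ← Algebra.trace_trace (S := F⟮α⟯)]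
  have h1 : α ^ j = algebraMap F⟮α⟯ K (AdjoinSimple.gen F α ^ j) := by
    rw [map_pow, AdjoinSimple.algebraMap_gen]
  rw [h1, Algebra.trace_algebraMap, map_nsmul, map_nsmul]
  congr 1
  apply (algebraMap F E).injective
  have hsep : Algebra.IsSeparable F F⟮α⟯ := inferInstance
  have : FiniteDimensional F F⟮α⟯ := adjoin.finiteDimensional hint
  rw [trace_eq_sum_embeddings (K := F) (L := F⟮α⟯) E]
  rw [← PowerSeries.coeff_map, nP_map _ _ hm0]
  have hspl : ((minpoly F α).map (algebraMap F E)).Splits := IsAlgClosed.splits _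
  have hprod := hspl.eq_prod_roots_of_monic ((minpoly.monic hint).map _)
  rw [hprod, coeff_nP_prod _ _ hj]
  let pb := adjoin.powerBasis hint
  have hgen : pb.gen = AdjoinSimple.gen F α := adjoin.powerBasis_gen hint
  have hmp : minpoly F pb.gen = minpoly F α := by
    rw [hgen]; exact minpoly_gen F α
  rw [Fintype.sum_equiv pb.liftEquiv' (fun σ : F⟮α⟯ →ₐ[F] E => σ (AdjoinSimple.gen F α ^ j)) (fun x => x.1 ^ j)]
  · rw [Finset.sum_mem_multiset _ _ (fun x => x ^ j) (fun x => rfl), Finset.sum_eq_multiset_sum, Multiset.toFinset_val,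
      Multiset.dedup_eq_self.mpr]
    · rw [hmp]
    · exact nodup_roots ((separable_map _).mpr (Algebra.IsSeparable.isSeparable F _))
  · intro σ
    rw [PowerBasis.liftEquiv'_apply_coe, map_pow, hgen]

lemma lam_eq_trace {F K : Type*} [Field F] [Finite F] [Field K] [Finite K] [Algebra F K] (f : F[X])
    (hf0 : f.coeff 0 = 0) (α : K) :
    lam f (minpoly F α ^ (Module.finrank F K / (minpoly F α).natDegree)) = Algebra.trace F K (aeval α f) := by
  rw [lam, aeval_eq_sum_range, map_sum]
  apply Finset.sum_congr rfl
  intro j _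
  rw [map_smul, smul_eq_mul]
  rcases eq_or_ne j 0 with rfl | h
  · simp [hf0]
  · rw [trace_pow_eq α j h]

end

end WeilB

namespace WeilB

open Polynomial UniqueFactorizationMonoid

noncomputable section

variable (F : Type) [Field F] [Finite F] (p : ℕ) [Fact p.Prime] [CharP F p]

/-- the degree r+1 extension -/
abbrev Kx (r : ℕ) : Type := FiniteField.Extension F p (r+1)

instance instFintypeKx (r : ℕ) : Fintype (Kx F p r) := Fintype.ofFinite _

def cc (r : ℕ) (α : Kx F p r) : F[X] := minpoly F α ^ ((r+1) / (minpoly F α).natDegree)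

lemma deg_dvd (r : ℕ) (α : Kx F p r) : (minpoly F α).natDegree ∣ r + 1 := by
  have := minpoly.degree_dvd (Algebra.IsIntegral.isIntegral (R := F) α)
  rwa [FiniteField.finrank_extension F p (r+1)] at this

lemma cc_monic (r : ℕ) (α : Kx F p r) : (cc F p r α).Monic :=
  (minpoly.monic (Algebra.IsIntegral.isIntegral (R := F) α)).pow _

lemma cc_natDegree (r : ℕ) (α : Kx F p r) : (cc F p r α).natDegree = r + 1 := by
  rw [cc, natDegree_pow, Nat.div_mul_cancel (deg_dvd F p r α)]

open Classical in
lemma count_r (g : F[X]) (hg : g ≠ 0) (r : ℕ) :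
    (Finset.univ.filter (fun α : Kx F p r => cc F p r α ∣ g)).card =
      ∑ P ∈ (normalizedFactors g).toFinset,
        if P.natDegree ∣ r + 1 ∧ P ^ ((r+1) / P.natDegree) ∣ g then P.natDegree else 0 := by
  rw [Finset.card_eq_sum_card_fiberwise (f := fun α : Kx F p r => minpoly F α) (t := (normalizedFactors g).toFinset)]
  · apply Finset.sum_congr rfl
    intro P hP
    rw [Multiset.mem_toFinset, mem_normalizedFactors_iff' hg] at hP
    obtain ⟨hirr, hnorm, hdvd⟩ := hP
    have hmon : P.Monic := by
      rw [← hnorm]; exact monic_normalize hirr.ne_zero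
    split_ifs with h
    · obtain ⟨h1, h2⟩ := h
      have hsep : P.Separable := PerfectField.separable_of_irreducible hirr
      have hspl : (P.map (algebraMap F (Kx F p r))).Splits := by
        have hd := (Irreducible.natDegree_dvd_iff_dvd_X_pow_card_pow_sub_X hirr).mp h1
        refine Splits.of_dvd ?_ ?_ (map_dvd (algebraMap F (Kx F p r)) hd)
        · exact IsSplittingField.splits (Kx F p r) (X ^ Nat.card F ^ (r+1) - X : F[X])
        · exact map_ne_zero (FiniteField.X_pow_card_pow_sub_X_ne_zero _ (by omega) Finite.one_lt_card)
      rw [← card_rootSet_eq_natDegree hsep hspl, ← Set.toFinset_card]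
      congr 1
      ext α
      rw [Set.mem_toFinset, mem_rootSet_of_ne hirr.ne_zero, Finset.mem_filter, Finset.mem_filter]
      constructor
      · rintro ⟨-, rfl⟩
        exact minpoly.aeval F α
      · intro hα
        have := minpoly.eq_of_irreducible_of_monic hirr hα hmon
        refine ⟨⟨Finset.mem_univ _, ?_⟩, this.symm⟩
        rw [cc, ← this]; exact h2
    · rw [Finset.card_eq_zero, Finset.filter_eq_empty_iff]
      intro α hα he
      apply h
      rw [Finset.mem_filter] at hα
      rw [← he]
      exact ⟨deg_dvd F p r α, hα.2⟩
  · intro α hα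
    simp only [Finset.coe_filter, Finset.mem_univ, true_and, Set.mem_ofPred_eq] at hα
    have hint := Algebra.IsIntegral.isIntegral (R := F) α
    simp only [Finset.mem_coe, Multiset.mem_toFinset]
    rw [mem_normalizedFactors_iff' hg]
    refine ⟨minpoly.irreducible hint, (minpoly.monic hint).normalize_eq_self, ?_⟩
    refine dvd_trans (dvd_pow_self _ ?_) hα
    have h1 := deg_dvd F p r α
    have h2 := minpoly.natDegree_pos hint
    have := Nat.div_pos (Nat.le_of_dvd (by omega) h1) h2
    omega

open Classical in
lemma count_all (g : F[X]) (hg : g.Monic) :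
    ∑ r ∈ Finset.range g.natDegree, (Finset.univ.filter (fun α : Kx F p r => cc F p r α ∣ g)).card = g.natDegree := by
  have hg0 := hg.ne_zero
  simp_rw [count_r F p g hg0]
  rw [Finset.sum_comm]
  have hdeg : g.natDegree = ∑ P ∈ (normalizedFactors g).toFinset, (normalizedFactors g).count P * P.natDegree := by
    conv_lhs => rw [← hg.normalize_eq_self, ← prod_normalizedFactors_eq hg0]
    rw [natDegree_multiset_prod_of_monic, Finset.sum_multiset_map_count]
    · simp
    · intro P hP
      rw [mem_normalizedFactors_iff' hg0] at hP
      rw [← hP.2.1]; exact monic_normalize hP.1.ne_zero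
  conv_rhs => rw [hdeg]
  apply Finset.sum_congr rfl
  intro P hP
  rw [Multiset.mem_toFinset, mem_normalizedFactors_iff' hg0] at hP
  obtain ⟨hirr, hnorm, hdvd⟩ := hP
  have hmon : P.Monic := by
    rw [← hnorm]; exact monic_normalize hirr.ne_zero
  have hpow : ∀ k : ℕ, P ^ k ∣ g ↔ k ≤ (normalizedFactors g).count P := by
    intro k
    rw [pow_dvd_iff_le_emultiplicity, emultiplicity_eq_count_normalizedFactors hirr hg0, hnorm]
    exact Nat.cast_le
  set v := (normalizedFactors g).count P
  set e := P.natDegree with he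
  have he1 : 0 < e := hirr.natDegree_pos
  have hev : v * e ≤ g.natDegree := by
    have := natDegree_le_of_dvd ((hpow v).mpr le_rfl) hg0
    rwa [natDegree_pow] at this
  rw [← Finset.sum_filter, Finset.sum_const, smul_eq_mul]
  congr 1
  rw [← Finset.card_range v]
  symm
  apply Finset.card_bij (fun k _ => (k+1) * e - 1)
  · intro k hk
    rw [Finset.mem_range] at hk
    have h1 : 1 ≤ (k+1) * e := Nat.mul_pos (by omega) he1
    have h2 : (k+1) * e ≤ v * e := Nat.mul_le_mul_right _ hk
    rw [Finset.mem_filter, Finset.mem_range, Nat.sub_add_cancel h1]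
    refine ⟨by omega, dvd_mul_left _ _, ?_⟩
    rw [Nat.mul_div_cancel _ he1, hpow]
    exact hk
  · intro k _ k' _ h
    have h1 : 1 ≤ (k+1) * e := Nat.mul_pos (by omega) he1
    have h2 : 1 ≤ (k'+1) * e := Nat.mul_pos (by omega) he1
    have h3 : (k+1) * e = (k'+1) * e := by omega
    have := Nat.eq_of_mul_eq_mul_right he1 h3
    omega
  · intro r hr
    rw [Finset.mem_filter, Finset.mem_range] at hr
    obtain ⟨h1, ⟨k, hk⟩, h3⟩ := hr
    rw [hk, Nat.mul_div_cancel_left _ he1, hpow] at h3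
    have hk0 : k ≠ 0 := by rintro rfl; simp at hk
    refine ⟨k - 1, by rw [Finset.mem_range]; omega, ?_⟩
    rw [Nat.sub_add_cancel (by omega), mul_comm, ← hk]
    rfl

def SS (f : F[X]) (ψ : AddChar F ℂ) (r : ℕ) : ℂ :=
  ∑ α : Kx F p r, ψ (Algebra.trace F (Kx F p r) (aeval α f))

lemma main_identity (f : F[X]) (hf0 : f.coeff 0 = 0) (ψ : AddChar F ℂ) (n : ℕ) :
    (n : ℂ) * AA f ψ n = ∑ r ∈ Finset.range n, SS F p f ψ r * AA f ψ (n - (r+1)) := by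
  classical
  have h1 : (n : ℂ) * AA f ψ n = ∑ g ∈ Mon F n, ∑ r ∈ Finset.range n, ∑ α : Kx F p r,
      if cc F p r α ∣ g then ψ (lam f g) else 0 := by
    rw [AA, Finset.mul_sum]
    apply Finset.sum_congr rfl
    intro g hg
    rw [mem_Mon] at hg
    have := count_all F p g hg.1
    rw [hg.2] at this
    have h2 : (n : ℂ) = ∑ r ∈ Finset.range n, (((Finset.univ.filter (fun α : Kx F p r => cc F p r α ∣ g)).card : ℕ) : ℂ) := by
      rw [← Nat.cast_sum, this]
    rw [h2, Finset.sum_mul]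
    apply Finset.sum_congr rfl
    intro r _
    rw [← Finset.sum_filter, Finset.sum_const, nsmul_eq_mul]
  rw [h1, Finset.sum_comm]
  apply Finset.sum_congr rfl
  intro r hr
  rw [Finset.mem_range] at hr
  rw [Finset.sum_comm, SS, Finset.sum_mul]
  apply Finset.sum_congr rfl
  intro α _
  rw [← Finset.sum_filter, AA, Finset.mul_sum]
  symm
  have hc := cc_monic F p r α
  have hcd := cc_natDegree F p r α
  apply Finset.sum_bij (fun h _ => cc F p r α * h)
  · intro h hh
    rw [mem_Mon] at hh
    rw [Finset.mem_filter, mem_Mon]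
    refine ⟨⟨hc.mul hh.1, ?_⟩, dvd_mul_right _ _⟩
    rw [hc.natDegree_mul hh.1, hcd, hh.2]; omega
  · intro a _ b _ e
    exact mul_left_cancel₀ hc.ne_zero e
  · intro g hg
    rw [Finset.mem_filter, mem_Mon] at hg
    obtain ⟨⟨hg1, hg2⟩, h, rfl⟩ := hg
    have hh := hc.of_mul_monic_left hg1
    refine ⟨h, ?_, rfl⟩
    rw [mem_Mon]
    refine ⟨hh, ?_⟩
    rw [hc.natDegree_mul hh, hcd] at hg2
    omega
  · intro h hh
    rw [mem_Mon] at hh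
    rw [lam_mul _ _ _ hc.ne_zero hh.1.ne_zero, AddChar.map_add_eq_mul]
    congr 2
    have := lam_eq_trace f hf0 α
    rw [FiniteField.finrank_extension F p (r+1)] at this
    rw [← this]
    rfl

end

end WeilB

namespace WeilB

open Polynomial

noncomputable section

lemma le_one_of_bounded (u : Multiset ℂ) (B : ℝ)
    (h : ∀ k : ℕ, ‖(u.map (fun w => w ^ (k+1))).sum‖ ≤ B) : ∀ v ∈ u, ‖v‖ ≤ 1 := by
  classical
  intro v hv
  by_contra hcon
  push Not at hcon
  let G : ℂ[X] := ∏ w ∈ u.toFinset.erase v, (X - C w)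
  have hGv : G.eval v ≠ 0 := by
    rw [eval_prod, Finset.prod_ne_zero_iff]
    intro w hw
    simp only [eval_sub, eval_X, eval_C]
    exact sub_ne_zero.mpr (Finset.ne_of_mem_erase hw).symm
  have hGw : ∀ w ∈ u, w ≠ v → G.eval w = 0 := by
    intro w hw hne
    rw [eval_prod]
    apply Finset.prod_eq_zero (i := w)
    · simp [hne, hw]
    · simp
  have hc : 0 < u.count v := Multiset.count_pos.mpr hv
  have hsum : ∀ k : ℕ, (u.map (fun w => w ^ (k+1) * G.eval w)).sum = u.count v * (v ^ (k+1) * G.eval v) := by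
    intro k
    rw [Finset.sum_multiset_map_count, Finset.sum_eq_single v]
    · rw [nsmul_eq_mul]
    · intro w hw hne
      rw [hGw w (Multiset.mem_toFinset.mp hw) hne, mul_zero, smul_zero]
    · intro hnot
      exact absurd (Multiset.mem_toFinset.mpr hv) hnot
  have hsum2 : ∀ k : ℕ, (u.map (fun w => w ^ (k+1) * G.eval w)).sum
      = ∑ j ∈ Finset.range (G.natDegree + 1), G.coeff j * (u.map (fun w => w ^ (k+j+1))).sum := by
    intro k
    simp_rw [← Multiset.sum_map_mul_left]
    rw [← Multiset.sum_map_sum]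
    congr 1
    apply Multiset.map_congr rfl
    intro w _
    rw [eval_eq_sum_range, Finset.mul_sum]
    apply Finset.sum_congr rfl
    intro j _
    ring
  set D : ℝ := ∑ j ∈ Finset.range (G.natDegree + 1), ‖G.coeff j‖ * B with hD
  have hb : ∀ k : ℕ, (u.count v : ℝ) * (‖v‖ ^ (k+1) * ‖G.eval v‖) ≤ D := by
    intro k
    have : (u.count v : ℝ) * (‖v‖ ^ (k+1) * ‖G.eval v‖) = ‖(u.count v : ℂ) * (v ^ (k+1) * G.eval v)‖ := by
      simp
    rw [this, ← hsum, hsum2]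
    refine (norm_sum_le _ _).trans (Finset.sum_le_sum ?_)
    intro j _
    rw [norm_mul]
    exact mul_le_mul_of_nonneg_left (h _) (norm_nonneg _)
  have hG0 : 0 < ‖G.eval v‖ := norm_pos_iff.mpr hGv
  have hc1 : (1:ℝ) ≤ u.count v := by exact_mod_cast hc
  obtain ⟨k, hk⟩ := pow_unbounded_of_one_lt (D / ‖G.eval v‖) hcon
  rw [div_lt_iff₀ hG0] at hk
  have h1 := hb k
  have h2 : ‖v‖ ^ k ≤ ‖v‖ ^ (k+1) := pow_le_pow_right₀ hcon.le (by omega)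
  have h3 : ‖v‖ ^ k * ‖G.eval v‖ ≤ ‖v‖ ^ (k+1) * ‖G.eval v‖ := mul_le_mul_of_nonneg_right h2 hG0.le
  have h4 : 0 ≤ ‖v‖ ^ (k+1) * ‖G.eval v‖ := by positivity
  nlinarith

lemma le_of_bounded (s : Multiset ℂ) (R B : ℝ) (hR : 0 < R)
    (h : ∀ k : ℕ, ‖(s.map (fun w => w ^ (2*(k+1)))).sum‖ ≤ B * R ^ (2*(k+1))) : ∀ v ∈ s, ‖v‖ ≤ R := by
  intro v hv
  have hRc : (R : ℂ) ≠ 0 := by exact_mod_cast hR.ne'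
  have := le_one_of_bounded (s.map (fun w => w ^ 2 * ((R:ℂ) ^ 2)⁻¹)) B ?_ (v ^ 2 * ((R:ℂ)^2)⁻¹) (Multiset.mem_map_of_mem _ hv)
  · rw [norm_mul, norm_inv, norm_pow, norm_pow, Complex.norm_real, Real.norm_eq_abs, abs_of_pos hR,
      ← div_eq_mul_inv, div_le_one (by positivity)] at this
    exact le_of_sq_le_sq this hR.le
  · intro k
    rw [Multiset.map_map]
    have : (fun w : ℂ => w ^ (k+1)) ∘ (fun w => w ^ 2 * ((R:ℂ) ^ 2)⁻¹) = fun w => w ^ (2*(k+1)) * ((R:ℂ) ^ (2*(k+1)))⁻¹ := by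
      funext w
      simp only [Function.comp, mul_pow, ← pow_mul, inv_pow]
    rw [this, Multiset.sum_map_mul_right, norm_mul, norm_inv, norm_pow, Complex.norm_real, Real.norm_eq_abs, abs_of_pos hR,
      ← div_eq_mul_inv, div_le_iff₀ (by positivity)]
    exact h k

lemma exists_roots (d : ℕ) (hd : 1 ≤ d) (A S : ℕ → ℂ) (hA0 : A 0 = 1) (hA : ∀ n, d ≤ n → A n = 0)
    (hrec : ∀ n : ℕ, (n : ℂ) * A n = ∑ r ∈ Finset.range n, S r * A (n - (r+1))) :
    ∃ s : Multiset ℂ, s.card = d - 1 ∧ ∀ r, (s.map (fun w => w ^ (r+1))).sum = - S r := by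
  let M : ℂ[X] := ∑ n ∈ Finset.range d, C (A n) * X ^ (d - 1 - n)
  have hMc : ∀ n < d, M.coeff (d-1-n) = A n := by
    intro n hn
    simp only [M, finsetSum_coeff, coeff_C_mul, coeff_X_pow]
    rw [Finset.sum_eq_single n]
    · simp
    · intro b hb hne
      rw [Finset.mem_range] at hb
      rw [if_neg (by omega), mul_zero]
    · intro h; simp at h; omega
  have hMd : M.natDegree ≤ d - 1 := by
    apply natDegree_sum_le_of_forall_le
    intro n _
    exact (natDegree_C_mul_X_pow_le _ _).trans (by omega)
  have hM1 : M.coeff (d-1) = 1 := by rw [← hA0, ← hMc 0 (by omega)]; simp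
  have hMm : M.Monic := monic_of_natDegree_le_of_coeff_eq_one _ hMd hM1
  have hMn : M.natDegree = d - 1 := by
    apply le_antisymm hMd
    apply le_natDegree_of_ne_zero
    rw [hM1]; exact one_ne_zero
  have hrv : ∀ n, PowerSeries.coeff n (rv M) = A n := by
    intro n
    rw [rv, Polynomial.coeff_coe, coeff_reverse, hMn]
    by_cases hn : n < d
    · rw [revAt_le (by omega), hMc n hn]
    · rw [hA n (by omega), revAt_eq_self_of_lt (by omega), coeff_eq_zero_of_natDegree_lt (by omega)]
  have hnP : nP M = PowerSeries.mk (fun n => if n = 0 then 0 else - S (n-1)) := by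
    apply nP_unique _ hMm.ne_zero
    ext n
    rw [PowerSeries.coeff_mul, Finset.Nat.sum_antidiagonal_eq_sum_range_succ_mk]
    simp only [PowerSeries.coeff_mk, hrv]
    rw [Finset.sum_range_succ']
    simp only [if_true, zero_mul, add_zero, Nat.add_sub_cancel]
    rcases n with _ | n
    · simp
    · rw [neg_mul, map_neg, PowerSeries.coeff_succ_X_mul, PowerSeries.coeff_derivative, hrv]
      have := hrec (n+1)
      push_cast at this
      rw [mul_comm, this, ← Finset.sum_neg_distrib]
      apply Finset.sum_congr rfl
      intro r _
      simp
  refine ⟨M.roots, ?_, ?_⟩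
  · rw [← hMn]
    exact (IsAlgClosed.splits M).natDegree_eq_card_roots.symm
  · intro r
    rw [← coeff_nP_prod _ _ (by omega), ← (IsAlgClosed.splits M).eq_prod_roots_of_monic hMm, hnP]
    simp

lemma SS_zero (F : Type) [Field F] [Fintype F] (p : ℕ) [Fact p.Prime] [CharP F p]
    (f : F[X]) (ψ : AddChar F ℂ) : SS F p f ψ 0 = ∑ z : F, ψ (f.eval z) := by
  have hfr : Module.finrank F (Kx F p 0) = 1 := FiniteField.finrank_extension F p (0+1)
  have hbij : Function.Bijective (algebraMap F (Kx F p 0)) := by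
    rw [Fintype.bijective_iff_injective_and_card]
    refine ⟨(algebraMap F (Kx F p 0)).injective, ?_⟩
    rw [Module.card_eq_pow_finrank (K := F) (V := Kx F p 0), hfr, pow_one]
  rw [SS]
  symm
  apply Fintype.sum_bijective _ hbij
  intro z
  rw [aeval_algebraMap_apply, Algebra.trace_algebraMap, hfr, one_smul]
  simp

theorem weil_trace (F : Type) [Field F] [Fintype F] (p m : ℕ) [hp : Fact p.Prime] [CharP F p] [Algebra (ZMod p) F]
    (hm : 1 ≤ m) (hF : Fintype.card F = p ^ m) (ψ₀ : AddChar (ZMod p) ℂ) (hψ₀ : ψ₀ ≠ 1)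
    (ψ : AddChar F ℂ) (hψ : ∀ y, ψ y = ψ₀ (Algebra.trace (ZMod p) F y))
    (f : F[X]) (hf0 : f.coeff 0 = 0) (hd : ¬ p ∣ f.natDegree) :
    ‖∑ z : F, ψ (f.eval z)‖ ≤ ((f.natDegree : ℝ) - 1) * Real.sqrt (p ^ m) := by
  set d := f.natDegree with hdd
  have hd1 : 1 ≤ d := by
    rcases Nat.eq_zero_or_pos d with h | h
    · rw [h] at hd; simp at hd
    · exact h
  have hψ1 : ψ ≠ 1 := by
    obtain ⟨x, hx⟩ := AddChar.ne_one_iff.mp hψ₀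
    obtain ⟨y, hy⟩ := Algebra.trace_surjective (ZMod p) F x
    apply AddChar.ne_one_iff.mpr
    exact ⟨y, by rw [hψ, hy]; exact hx⟩
  have hdF : (d : F) ≠ 0 := by
    rw [Ne, CharP.cast_eq_zero_iff F p]; exact hd
  obtain ⟨s, hs, hsS⟩ := exists_roots d hd1 (AA f ψ) (SS F p f ψ) (AA_zero f ψ)
    (fun n hn => AA_eq_zero f hdF ψ hψ1 n hn) (main_identity F p f hf0 ψ)
  have hp0 : (0:ℝ) < p := by exact_mod_cast hp.out.pos
  have hq : (0:ℝ) < (p:ℝ)^m := by positivity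
  have hR : 0 < Real.sqrt (p ^ m) := Real.sqrt_pos.mpr hq
  have hb : ∀ v ∈ s, ‖v‖ ≤ Real.sqrt (p ^ m) := by
    apply le_of_bounded s _ (3 * d * p) hR
    intro k
    have e1 : 2 * (k+1) = (2*k+1) + 1 := by ring
    rw [e1, hsS, norm_neg, ← e1, pow_mul, Real.sq_sqrt hq.le]
    obtain ⟨μ, hμ⟩ : ∃ μ, m * (k+1) = μ + 1 := ⟨m * (k+1) - 1, by
      have : 1 ≤ m * (k+1) := Nat.mul_pos hm (by omega)
      omega⟩
    have hcard : Fintype.card (Kx F p (2*k+1)) = (p ^ (μ+1)) ^ 2 := by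
      rw [Fintype.card_eq_nat_card, FiniteField.natCard_extension, ← Fintype.card_eq_nat_card, hF,
        ← pow_mul, ← pow_mul, ← hμ]
      congr 1; ring
    have := charsum_bound p (Kx F p (2*k+1)) μ hcard (f.map (algebraMap F _)) (by rwa [natDegree_map]) ψ₀ hψ₀
    rw [natDegree_map] at this
    rw [← pow_mul, hμ]
    convert! this using 2
    rw [SS]
    apply Finset.sum_congr rfl
    intro α _
    rw [hψ, Algebra.trace_trace, eval_map_algebraMap]
  rw [← SS_zero F p f ψ]
  have h0 := hsS 0
  rw [← norm_neg, ← h0]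
  have hle : ∀ t : Multiset ℂ, (∀ v ∈ t, ‖v‖ ≤ Real.sqrt (p ^ m)) →
      ‖(t.map (fun w => w ^ (0+1))).sum‖ ≤ t.card * Real.sqrt (p ^ m) := by
    intro t
    induction t using Multiset.induction_on with
    | empty => simp
    | cons a t ih =>
      intro h
      rw [Multiset.map_cons, Multiset.sum_cons, Multiset.card_cons]
      refine (norm_add_le _ _).trans ?_
      have h1 := ih (fun v hv => h v (Multiset.mem_cons_of_mem hv))
      have h2 := h a (Multiset.mem_cons_self a t)
      rw [zero_add, pow_one]
      simp only [zero_add] at h1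
      push_cast
      linarith
  refine (hle s hb).trans ?_
  rw [hs, Nat.cast_sub hd1, Nat.cast_one]

theorem weil (F : Type) [Field F] [Fintype F] (p m : ℕ) (hp : p.Prime)
    (hm : 1 ≤ m) (hF : Fintype.card F = p ^ m)
    (ψ : AddChar F ℂ) (hψ : ψ ≠ 1)
    (f : F[X]) (hf0 : f.coeff 0 = 0) (hd : ¬ p ∣ f.natDegree) :
    ‖∑ z : F, ψ (f.eval z)‖ ≤ ((f.natDegree : ℝ) - 1) * Real.sqrt (p ^ m) := by
  have : Fact p.Prime := ⟨hp⟩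
  have : CharP F p := by
    obtain ⟨p', hp'⟩ := CharP.exists F
    obtain ⟨n, hpr, hn⟩ := FiniteField.card F p'
    have : p' = p := by
      rw [hF] at hn
      have h1 : p ∣ p' ^ (n:ℕ) := by rw [← hn]; exact dvd_pow_self _ (by omega)
      exact ((Nat.prime_dvd_prime_iff_eq hp hpr).mp (hp.dvd_of_dvd_pow h1)).symm
    rwa [← this]
  let : Algebra (ZMod p) F := ZMod.algebra F p
  let ψ₀ : AddChar (ZMod p) ℂ := ZMod.stdAddChar
  have hψ₀ : ψ₀ ≠ 1 := by
    have := ZMod.isPrimitive_stdAddChar p (one_ne_zero)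
    rwa [AddChar.mulShift_one] at this
  let ψ₁ : AddChar F ℂ := ψ₀.compAddMonoidHom (Algebra.trace (ZMod p) F).toAddMonoidHom
  have hψ₁a : ∀ y, ψ₁ y = ψ₀ (Algebra.trace (ZMod p) F y) := fun y => rfl
  have hψ₁ : ψ₁ ≠ 1 := by
    obtain ⟨x, hx⟩ := AddChar.ne_one_iff.mp hψ₀
    obtain ⟨y, hy⟩ := Algebra.trace_surjective (ZMod p) F x
    exact AddChar.ne_one_iff.mpr ⟨y, by rw [hψ₁a, hy]; exact hx⟩
  have hinj := AddChar.to_mulShift_inj_of_isPrimitive (AddChar.IsPrimitive.of_ne_one hψ₁)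
  have hbij : Function.Bijective ψ₁.mulShift := by
    rw [Fintype.bijective_iff_injective_and_card]
    exact ⟨hinj, (AddChar.card_eq).symm⟩
  obtain ⟨a, ha⟩ := hbij.2 ψ
  have ha0 : a ≠ 0 := by
    rintro rfl
    apply hψ
    rw [← ha, AddChar.mulShift_zero]
  have hdeg : (C a * f).natDegree = f.natDegree := natDegree_C_mul ha0
  have := weil_trace F p m hm hF ψ₀ hψ₀ ψ₁ hψ₁a (C a * f) (by simp [hf0]) (by rwa [hdeg])
  rw [hdeg] at this
  convert this using 3
  rw [← ha]
  simp [AddChar.mulShift_apply]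

end

end WeilB

namespace WeilB

open Polynomial

theorem final_bound (b m : ℕ) (hb : Nat.Prime b) (hm : 1 ≤ m)
    (F : Type) [Field F] [Fintype F] (hF : Fintype.card F = b ^ m)
    (s : ℕ) (hs : 1 ≤ s)
    (c : Fin s → ℕ) (hc : ∀ j : Fin s, ¬ b ∣ c j ∧ c j - c j / b = (j : ℕ) + 1)
    (a : Fin s → F) (ha : a ≠ 0)
    (ψ : AddChar F ℂ) (hψ : ψ ≠ 1) :
    ‖∑ z : F, ψ (∑ j : Fin s, a j * z ^ (c j))‖
      ≤ ((s : ℝ) * b / ((b : ℝ) - 1) - 1) * Real.sqrt (b ^ m) := by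
  classical
  have hinj : ∀ i j, c i = c j → i = j := by
    intro i j h
    have h1 := (hc i).2
    have h2 := (hc j).2
    rw [h] at h1
    apply Fin.ext
    omega
  let f : F[X] := ∑ j : Fin s, C (a j) * X ^ (c j)
  have hcoef : ∀ n, f.coeff n = ∑ j : Fin s, if n = c j then a j else 0 := by
    intro n
    simp only [f, finsetSum_coeff, coeff_C_mul, coeff_X_pow]
    apply Finset.sum_congr rfl
    intro j _
    split_ifs <;> simp
  have hne : ∀ n, f.coeff n ≠ 0 → ∃ j, n = c j := by
    intro n hn
    rw [hcoef] at hn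
    obtain ⟨j, -, hj⟩ := Finset.exists_ne_zero_of_sum_ne_zero hn
    refine ⟨j, ?_⟩
    by_contra h
    rw [if_neg h] at hj
    exact hj rfl
  have hf : f ≠ 0 := by
    obtain ⟨j, hj⟩ := Function.ne_iff.mp ha
    intro h0
    apply hj
    have := hcoef (c j)
    rw [h0, coeff_zero, Finset.sum_eq_single j] at this
    · simpa using this.symm
    · intro i _ hij
      rw [if_neg]
      intro h
      exact hij (hinj _ _ h.symm)
    · simp
  have hf0 : f.coeff 0 = 0 := by
    by_contra h
    obtain ⟨j, hj⟩ := hne 0 h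
    apply (hc j).1
    rw [← hj]; simp
  obtain ⟨j, hj⟩ := hne f.natDegree (leadingCoeff_ne_zero.mpr hf)
  have hw := WeilB.weil F b m hb hm hF ψ hψ f hf0 (by rw [hj]; exact (hc j).1)
  have heq : ∀ z, f.eval z = ∑ j : Fin s, a j * z ^ (c j) := by
    intro z
    simp [f, eval_finsetSum]
  simp only [heq] at hw
  refine hw.trans ?_
  apply mul_le_mul_of_nonneg_right _ (Real.sqrt_nonneg _)
  apply sub_le_sub_right
  have hb2 : (2:ℝ) ≤ b := by exact_mod_cast hb.two_le
  rw [le_div_iff₀ (by linarith)]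
  have h1 : (f.natDegree - f.natDegree / b : ℕ) ≤ s := by
    rw [hj, (hc j).2]; exact j.2
  have h2 : b * (f.natDegree / b) ≤ f.natDegree := Nat.mul_div_le _ _
  have h1' : (f.natDegree : ℝ) ≤ s + (f.natDegree / b : ℕ) := by
    have : f.natDegree ≤ s + f.natDegree / b := by omega
    exact_mod_cast this
  have h2' : (b:ℝ) * (f.natDegree / b : ℕ) ≤ f.natDegree := by exact_mod_cast h2
  nlinarith

end WeilB

/-- **Weil bound for the polynomials used in the Walsh-series construction
(Proposition 3).**  Let `F` be a finite field with `b^m` elements (`b` prime, `m ≥ 1`),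
let `c_j` be the `j`-th positive integer not divisible by `b` (characterized by
`b ∤ c_j` and `c_j - ⌊c_j/b⌋ = j`), let `a₁, …, a_s ∈ F` be not all zero, and let `ψ`
be a non-trivial additive character of `F`.  Then
`|∑_{z ∈ F} ψ(a₁ z^{c₁} + ⋯ + a_s z^{c_s})| ≤ (s·b/(b-1) - 1) √(b^m)`. -/
theorem stmt_15 (b m : ℕ) (hb : Nat.Prime b) (hm : 1 ≤ m)
    (F : Type) [Field F] [Fintype F] (hF : Fintype.card F = b ^ m)
    (s : ℕ) (hs : 1 ≤ s)
    (c : Fin s → ℕ) (hc : ∀ j : Fin s, ¬ b ∣ c j ∧ c j - c j / b = (j : ℕ) + 1)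
    (a : Fin s → F) (ha : a ≠ 0)
    (ψ : AddChar F ℂ) (hψ : ψ ≠ 1) :
    ‖∑ z : F, ψ (∑ j : Fin s, a j * z ^ (c j))‖
      ≤ ((s : ℝ) * b / ((b : ℝ) - 1) - 1) * Real.sqrt (b ^ m) := by
  exact WeilB.final_bound b m hb hm F hF s hs c hc a ha ψ hψ
end
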